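/- arXiv:0906.3332 — 3 statements merged into one kernel-verified Lean document; each statement's English description precedes it below -/
import Mathlib

section
/- For every recursively enumerable language L over an alphabet Σ there exists a grammar/observer system Ω = (G, A), where G is a context-free grammar (in fact it can be taken locally commutative context-free) and A is a monadic transducer with output alphabet Σ ∪ {⊥}, such that L_{⊥,f}(Ω) = L. That is, grammar/observer systems with context-free underlying grammars are computationally complete. -/
/-!  Common definitions for "computing by observing" G/O systems.

A monadic transducer with input alphabet `V` and output alphabet `Γ` is modelled by its
input/output function `A : List V → Option Γ` (`none` standing for the empty output `λ`),
together with the property `ObserverRegular A` saying that every fiber of `A` is a regular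
language (equivalently, `A` is computed by a complete deterministic finite automaton whose
states are labelled by `Γ ∪ {λ}`).

For a G/O system the output alphabet is `Σ ∪ {⊥}`, modelled as `Option Sig` with
`none` standing for `⊥`; hence observers of G/O systems have type
`List (Symbol T G.NT) → Option (Option Sig)`. -/

/-- Every fiber of the transducer map is a regular language (and the fibers obviously
partition `V*`): this characterizes maps computed by complete deterministic finite
automata with output-labelled states, i.e. monadic transducers. -/
def ObserverRegular {V Γ : Type*} (A : List V → Option Γ) : Prop :=
  ∀ o : Option Γ, Language.IsRegular ({ w : List V | A w = o } : Language V)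

/-- The number of occurrences of nonterminal symbols in a sentential form. -/
def nonterminalCount {T NT : Type*} (w : List (Symbol T NT)) : ℕ :=
  (w.filter fun s => match s with | Symbol.nonterminal _ => true | _ => false).length

/-- The language `L_f(Ω)` (free mode) of the G/O system `Ω = (G, A)`, a language over the
alphabet `Σ ∪ {⊥}` (= `Option Sig`, `none` being `⊥`): all concatenations
`A(w₀)A(w₁)⋯A(wₙ)` of observer outputs along terminating derivations
`S = w₀ ⇒ w₁ ⇒ ⋯ ⇒ wₙ` of `G` with `wₙ` consisting of terminals only. -/
def goLang {T : Type} (G : ContextFreeGrammar T) {Sig : Type}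
    (A : List (Symbol T G.NT) → Option (Option Sig)) : Language (Option Sig) :=
  { x | ∃ ws : List (List (Symbol T G.NT)),
      ws.head? = some [Symbol.nonterminal G.initial] ∧
      List.Chain' G.Produces ws ∧
      (∃ t : List T, ws.getLast? = some (t.map Symbol.terminal)) ∧
      x = (ws.map fun w => (A w).toList).flatten }

/-- The language `L_{⊥,f}(Ω) = L_f(Ω) ∩ Σ*`: the words of `L_f(Ω)` containing no `⊥`,
viewed as a language over `Σ`. -/
def goLangBot {T : Type} (G : ContextFreeGrammar T) {Sig : Type}
    (A : List (Symbol T G.NT) → Option (Option Sig)) : Language Sig :=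
  { x | (x.map some) ∈ goLang G A }

namespace GO

open Function Relation

/-- Instructions of a nondeterministic counter machine with output. -/
inductive Ins (Sig : Type) : Type
  | nop : Ins Sig
  | inc (r : ℕ) : Ins Sig
  | dec (r : ℕ) : Ins Sig
  | zero (r : ℕ) : Ins Sig
  | out (a : Sig) : Ins Sig

abbrev Cfg (Sig : Type) := (ℕ → ℕ) × List Sig

def Ins.act {Sig : Type} : Ins Sig → Cfg Sig → Cfg Sig → Prop
  | .nop, c, c' => c' = c
  | .inc r, c, c' => c' = (update c.1 r (c.1 r + 1), c.2)
  | .dec r, c, c' => c.1 r ≠ 0 ∧ c' = (update c.1 r (c.1 r - 1), c.2)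
  | .zero r, c, c' => c.1 r = 0 ∧ c' = c
  | .out a, c, c' => c' = (c.1, c.2 ++ [a])

structure Mach (Sig : Type) where
  Q : Type
  fin : Finite Q
  E : Set (Q × Ins Sig × Q)
  efin : E.Finite
  st : Q
  ha : Q

def Mach.Step {Sig : Type} (M : Mach Sig) (x y : M.Q × Cfg Sig) : Prop :=
  ∃ i, (x.1, i, y.1) ∈ M.E ∧ i.act x.2 y.2

def Rz {Sig : Type} (R : Cfg Sig → Cfg Sig → Prop) : Prop :=
  ∃ M : Mach Sig, ∀ c c', R c c' ↔ ReflTransGen M.Step (M.st, c) (M.ha, c')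

variable {Sig : Type}

theorem Rz.congr {R R' : Cfg Sig → Cfg Sig → Prop} (h : Rz R) (e : ∀ c c', R c c' ↔ R' c c') :
    Rz R' := by
  obtain ⟨M, hM⟩ := h
  exact ⟨M, fun c c' => (e c c').symm.trans (hM c c')⟩

theorem Rz.ins (i : Ins Sig) : Rz i.act := by
  refine ⟨⟨Bool, inferInstance, {(false, i, true)}, Set.finite_singleton _, false, true⟩, ?_⟩
  intro c c'
  constructor
  · intro h
    exact ReflTransGen.single ⟨i, rfl, h⟩
  · intro h
    rcases ReflTransGen.cases_head h with h | ⟨⟨q, d⟩, ⟨j, hj, hd⟩, h2⟩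
    · simp at h
    · simp only [Set.mem_singleton_iff, Prod.mk.injEq, true_and] at hj
      obtain ⟨rfl, rfl⟩ := hj
      rcases ReflTransGen.cases_head h2 with h | ⟨⟨q, d'⟩, ⟨j', hj', hd'⟩, h3⟩
      · simp only [Prod.mk.injEq, true_and] at h
        exact h ▸ hd
      · simp at hj'

theorem Rz.seq {R₁ R₂ : Cfg Sig → Cfg Sig → Prop} (h₁ : Rz R₁) (h₂ : Rz R₂) :
    Rz (Comp R₁ R₂) := by
  obtain ⟨M, hM⟩ := h₁
  obtain ⟨N, hN⟩ := h₂
  have := M.fin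
  have := N.fin
  let E : Set ((M.Q ⊕ N.Q) × Ins Sig × (M.Q ⊕ N.Q)) :=
    ((fun e : M.Q × Ins Sig × M.Q => (Sum.inl e.1, e.2.1, Sum.inl e.2.2)) '' M.E) ∪
    ((fun e : N.Q × Ins Sig × N.Q => (Sum.inr e.1, e.2.1, Sum.inr e.2.2)) '' N.E) ∪
    {(Sum.inl M.ha, Ins.nop, Sum.inr N.st)}
  have hE : E.Finite := ((M.efin.image _).union (N.efin.image _)).union (Set.finite_singleton _)
  let K : Mach Sig := ⟨M.Q ⊕ N.Q, inferInstance, E, hE, Sum.inl M.st, Sum.inr N.ha⟩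
  refine ⟨K, fun c c' => ?_⟩
  constructor
  · rintro ⟨b, h1, h2⟩
    rw [hM] at h1
    rw [hN] at h2
    have a1 : ReflTransGen K.Step (Sum.inl M.st, c) (Sum.inl M.ha, b) :=
      ReflTransGen.lift (fun x : M.Q × Cfg Sig => ((Sum.inl x.1, x.2) : K.Q × Cfg Sig))
        (by
          rintro ⟨q, x⟩ ⟨q', x'⟩ ⟨i, hi, ha⟩
          exact ⟨i, Or.inl (Or.inl ⟨_, hi, rfl⟩), ha⟩) _ _ h1
    have a2 : ReflTransGen K.Step (Sum.inr N.st, b) (Sum.inr N.ha, c') :=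
      ReflTransGen.lift (fun x : N.Q × Cfg Sig => ((Sum.inr x.1, x.2) : K.Q × Cfg Sig))
        (by
          rintro ⟨q, x⟩ ⟨q', x'⟩ ⟨i, hi, ha⟩
          exact ⟨i, Or.inl (Or.inr ⟨_, hi, rfl⟩), ha⟩) _ _ h2
    have a3 : K.Step (Sum.inl M.ha, b) (Sum.inr N.st, b) :=
      ⟨Ins.nop, Or.inr rfl, rfl⟩
    exact (a1.tail a3).trans a2
  · intro h
    have key : ∀ z : K.Q × Cfg Sig, ReflTransGen K.Step (Sum.inl M.st, c) z →
        (∀ q, z.1 = Sum.inl q → ReflTransGen M.Step (M.st, c) (q, z.2)) ∧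
        (∀ q, z.1 = Sum.inr q → ∃ b, R₁ c b ∧ ReflTransGen N.Step (N.st, b) (q, z.2)) := by
      intro z hz
      induction hz with
      | refl =>
        refine ⟨?_, ?_⟩
        · intro q hq
          cases hq
          exact ReflTransGen.refl
        · intro q hq
          cases hq
      | tail _ hs ih =>
        rename_i y z _
        obtain ⟨y, d⟩ := y
        obtain ⟨z, d'⟩ := z
        obtain ⟨i, hi, ha⟩ := hs
        rcases hi with (⟨⟨q, j, q'⟩, he, heq⟩ | ⟨⟨q, j, q'⟩, he, heq⟩) | heq
        · simp only [Prod.mk.injEq] at heq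
          obtain ⟨rfl, rfl, rfl⟩ := heq
          refine ⟨?_, ?_⟩
          · intro p hp
            cases hp
            exact (ih.1 _ rfl).tail ⟨j, he, ha⟩
          · intro p hp
            cases hp
        · simp only [Prod.mk.injEq] at heq
          obtain ⟨rfl, rfl, rfl⟩ := heq
          refine ⟨?_, ?_⟩
          · intro p hp
            cases hp
          · intro p hp
            cases hp
            obtain ⟨b, hb, hr⟩ := ih.2 _ rfl
            exact ⟨b, hb, hr.tail ⟨j, he, ha⟩⟩
        · simp only [Set.mem_singleton_iff, Prod.mk.injEq] at heq
          obtain ⟨rfl, rfl, rfl⟩ := heq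
          refine ⟨?_, ?_⟩
          · intro p hp
            cases hp
          · intro p hp
            cases hp
            cases ha
            exact ⟨d, (hM _ _).2 (ih.1 _ rfl), ReflTransGen.refl⟩
    obtain ⟨b, hb, hr⟩ := (key _ h).2 _ rfl
    exact ⟨b, hb, (hN _ _).2 hr⟩

theorem Rz.star {R : Cfg Sig → Cfg Sig → Prop} (h₁ : Rz R) :
    Rz (ReflTransGen R) := by
  obtain ⟨M, hM⟩ := h₁
  have := M.fin
  let E : Set (Option M.Q × Ins Sig × Option M.Q) :=
    ((fun e : M.Q × Ins Sig × M.Q => (some e.1, e.2.1, some e.2.2)) '' M.E) ∪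
    {(none, Ins.nop, some M.st), (some M.ha, Ins.nop, none)}
  have hE : E.Finite := (M.efin.image _).union (Set.toFinite _)
  let K : Mach Sig := ⟨Option M.Q, inferInstance, E, hE, none, none⟩
  refine ⟨K, fun c c' => ?_⟩
  constructor
  · intro h
    induction h with
    | refl => exact ReflTransGen.refl
    | tail _ hs ih =>
      rename_i b d _
      rw [hM] at hs
      have a1 : ReflTransGen K.Step (some M.st, b) (some M.ha, d) :=
        ReflTransGen.lift (fun x : M.Q × Cfg Sig => ((some x.1, x.2) : K.Q × Cfg Sig))
          (by
            rintro ⟨q, x⟩ ⟨q', x'⟩ ⟨i, hi, ha⟩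
            exact ⟨i, Or.inl ⟨_, hi, rfl⟩, ha⟩) _ _ hs
      have a2 : K.Step (none, b) (some M.st, b) := ⟨Ins.nop, Or.inr (Or.inl rfl), rfl⟩
      have a3 : K.Step (some M.ha, d) (none, d) := ⟨Ins.nop, Or.inr (Or.inr rfl), rfl⟩
      exact ((ih.tail a2).trans a1).tail a3
  · intro h
    have key : ∀ z : K.Q × Cfg Sig, ReflTransGen K.Step (none, c) z →
        (z.1 = none → ReflTransGen R c z.2) ∧
        (∀ q, z.1 = some q → ∃ b, ReflTransGen R c b ∧
          ReflTransGen M.Step (M.st, b) (q, z.2)) := by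
      intro z hz
      induction hz with
      | refl =>
        refine ⟨fun _ => ReflTransGen.refl, ?_⟩
        intro q hq
        cases hq
      | tail _ hs ih =>
        rename_i y z _
        obtain ⟨y, d⟩ := y
        obtain ⟨z, d'⟩ := z
        obtain ⟨i, hi, ha⟩ := hs
        rcases hi with ⟨⟨q, j, q'⟩, he, heq⟩ | heq | heq
        · simp only [Prod.mk.injEq] at heq
          obtain ⟨rfl, rfl, rfl⟩ := heq
          refine ⟨?_, ?_⟩
          · intro hp
            cases hp
          · intro p hp
            cases hp
            obtain ⟨b, hb, hr⟩ := ih.2 _ rfl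
            exact ⟨b, hb, hr.tail ⟨j, he, ha⟩⟩
        · simp only [Prod.mk.injEq] at heq
          obtain ⟨rfl, rfl, rfl⟩ := heq
          cases ha
          refine ⟨?_, ?_⟩
          · intro hp
            cases hp
          · intro p hp
            cases hp
            exact ⟨d, ih.1 rfl, ReflTransGen.refl⟩
        · simp only [Set.mem_singleton_iff, Prod.mk.injEq] at heq
          obtain ⟨rfl, rfl, rfl⟩ := heq
          cases ha
          refine ⟨?_, ?_⟩
          · intro _
            obtain ⟨b, hb, hr⟩ := ih.2 _ rfl
            exact hb.tail ((hM _ _).2 hr)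
          · intro p hp
            cases hp
    exact (key _ h).1 rfl

theorem Rz.alt {R₁ R₂ : Cfg Sig → Cfg Sig → Prop} (h₁ : Rz R₁) (h₂ : Rz R₂) :
    Rz (fun c c' => R₁ c c' ∨ R₂ c c') := by
  obtain ⟨M, hM⟩ := h₁
  obtain ⟨N, hN⟩ := h₂
  have := M.fin
  have := N.fin
  let E : Set ((M.Q ⊕ N.Q ⊕ Bool) × Ins Sig × (M.Q ⊕ N.Q ⊕ Bool)) :=
    ((fun e : M.Q × Ins Sig × M.Q => (Sum.inl e.1, e.2.1, Sum.inl e.2.2)) '' M.E) ∪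
    ((fun e : N.Q × Ins Sig × N.Q =>
      (Sum.inr (Sum.inl e.1), e.2.1, Sum.inr (Sum.inl e.2.2))) '' N.E) ∪
    {(Sum.inr (Sum.inr false), Ins.nop, Sum.inl M.st),
     (Sum.inr (Sum.inr false), Ins.nop, Sum.inr (Sum.inl N.st)),
     (Sum.inl M.ha, Ins.nop, Sum.inr (Sum.inr true)),
     (Sum.inr (Sum.inl N.ha), Ins.nop, Sum.inr (Sum.inr true))}
  have hE : E.Finite := ((M.efin.image _).union (N.efin.image _)).union (Set.toFinite _)
  let K : Mach Sig := ⟨M.Q ⊕ N.Q ⊕ Bool, inferInstance, E, hE,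
    Sum.inr (Sum.inr false), Sum.inr (Sum.inr true)⟩
  refine ⟨K, fun c c' => ?_⟩
  constructor
  · rintro (h | h)
    · rw [hM] at h
      have a1 : ReflTransGen K.Step (Sum.inl M.st, c) (Sum.inl M.ha, c') :=
        ReflTransGen.lift (fun x : M.Q × Cfg Sig => ((Sum.inl x.1, x.2) : K.Q × Cfg Sig))
          (by
            rintro ⟨q, x⟩ ⟨q', x'⟩ ⟨i, hi, ha⟩
            exact ⟨i, Or.inl (Or.inl ⟨_, hi, rfl⟩), ha⟩) _ _ h
      have a2 : K.Step (K.st, c) (Sum.inl M.st, c) := ⟨Ins.nop, Or.inr (by simp [K]), rfl⟩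
      have a3 : K.Step (Sum.inl M.ha, c') (K.ha, c') := ⟨Ins.nop, Or.inr (by simp [K]), rfl⟩
      exact (ReflTransGen.head a2 a1).tail a3
    · rw [hN] at h
      have a1 : ReflTransGen K.Step (Sum.inr (Sum.inl N.st), c) (Sum.inr (Sum.inl N.ha), c') :=
        ReflTransGen.lift
          (fun x : N.Q × Cfg Sig => ((Sum.inr (Sum.inl x.1), x.2) : K.Q × Cfg Sig))
          (by
            rintro ⟨q, x⟩ ⟨q', x'⟩ ⟨i, hi, ha⟩
            exact ⟨i, Or.inl (Or.inr ⟨_, hi, rfl⟩), ha⟩) _ _ h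
      have a2 : K.Step (K.st, c) (Sum.inr (Sum.inl N.st), c) :=
        ⟨Ins.nop, Or.inr (by simp [K]), rfl⟩
      have a3 : K.Step (Sum.inr (Sum.inl N.ha), c') (K.ha, c') :=
        ⟨Ins.nop, Or.inr (by simp [K]), rfl⟩
      exact (ReflTransGen.head a2 a1).tail a3
  · intro h
    have key : ∀ z : K.Q × Cfg Sig, ReflTransGen K.Step (K.st, c) z →
        (∀ q, z.1 = Sum.inl q → ReflTransGen M.Step (M.st, c) (q, z.2)) ∧
        (∀ q, z.1 = Sum.inr (Sum.inl q) → ReflTransGen N.Step (N.st, c) (q, z.2)) ∧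
        (z.1 = Sum.inr (Sum.inr false) → z.2 = c) ∧
        (z.1 = Sum.inr (Sum.inr true) → R₁ c z.2 ∨ R₂ c z.2) := by
      intro z hz
      induction hz with
      | refl => simp [K]
      | tail _ hs ih =>
        rename_i y z _
        obtain ⟨y, d⟩ := y
        obtain ⟨z, d'⟩ := z
        obtain ⟨i, hi, ha⟩ := hs
        rcases hi with (⟨⟨q, j, q'⟩, he, heq⟩ | ⟨⟨q, j, q'⟩, he, heq⟩) | heq | heq | heq | heq
        · simp only [Prod.mk.injEq] at heq
          obtain ⟨rfl, rfl, rfl⟩ := heq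
          refine ⟨?_, (fun _ h => by cases h), (fun h => by cases h), (fun h => by cases h)⟩
          intro p hp
          cases hp
          exact (ih.1 _ rfl).tail ⟨j, he, ha⟩
        · simp only [Prod.mk.injEq] at heq
          obtain ⟨rfl, rfl, rfl⟩ := heq
          refine ⟨(fun _ h => by cases h), ?_, (fun h => by cases h), (fun h => by cases h)⟩
          intro p hp
          cases hp
          exact (ih.2.1 _ rfl).tail ⟨j, he, ha⟩
        · simp only [Prod.mk.injEq] at heq
          obtain ⟨rfl, rfl, rfl⟩ := heq
          cases ha
          refine ⟨?_, (fun _ h => by cases h), (fun h => by cases h), (fun h => by cases h)⟩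
          intro p hp
          cases hp
          have := ih.2.2.1 rfl
          simp only at this
          subst this
          exact ReflTransGen.refl
        · simp only [Prod.mk.injEq] at heq
          obtain ⟨rfl, rfl, rfl⟩ := heq
          cases ha
          refine ⟨(fun _ h => by cases h), ?_, (fun h => by cases h), (fun h => by cases h)⟩
          intro p hp
          cases hp
          have := ih.2.2.1 rfl
          simp only at this
          subst this
          exact ReflTransGen.refl
        · simp only [Prod.mk.injEq] at heq
          obtain ⟨rfl, rfl, rfl⟩ := heq
          cases ha
          refine ⟨(fun _ h => by cases h), (fun _ h => by cases h), (fun h => by cases h), fun _ => Or.inl ?_⟩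
          exact (hM _ _).2 (ih.1 _ rfl)
        · simp only [Set.mem_singleton_iff, Prod.mk.injEq] at heq
          obtain ⟨rfl, rfl, rfl⟩ := heq
          cases ha
          refine ⟨(fun _ h => by cases h), (fun _ h => by cases h), (fun h => by cases h), fun _ => Or.inr ?_⟩
          exact (hN _ _).2 (ih.2.1 _ rfl)
    exact (key _ h).2.2.2 rfl

theorem Rz.empty : Rz (fun _ _ : Cfg Sig => False) := by
  refine ⟨⟨Bool, inferInstance, ∅, Set.finite_empty, false, true⟩, fun c c' => ?_⟩
  constructor
  · exact False.elim
  · intro h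
    rcases ReflTransGen.cases_head h with h | ⟨⟨q, d⟩, ⟨j, hj, hd⟩, h2⟩
    · simp at h
    · exact hj

theorem Rz.exists_fin [Finite Sig] {R : Sig → Cfg Sig → Cfg Sig → Prop} (h : ∀ a, Rz (R a)) :
    Rz (fun c c' => ∃ a, R a c c') := by
  have key : ∀ l : List Sig, Rz (fun c c' => ∃ a ∈ l, R a c c') := by
    intro l
    induction l with
    | nil => exact Rz.empty.congr (by simp)
    | cons a l ih => exact ((h a).alt ih).congr (by simp)
  have := Fintype.ofFinite Sig
  exact (key Finset.univ.toList).congr (by simp)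

theorem star_iff {α : Type*} {R : α → α → Prop} (c : ℕ → α) (cond : ℕ → Prop)
    (h : ∀ i c', R (c i) c' ↔ cond i ∧ c' = c (i + 1)) (c' : α) :
    ReflTransGen R (c 0) c' ↔ ∃ n, (∀ i < n, cond i) ∧ c' = c n := by
  constructor
  · intro hr
    induction hr with
    | refl => exact ⟨0, by simp, rfl⟩
    | tail _ hs ih =>
      obtain ⟨n, hn, rfl⟩ := ih
      obtain ⟨h1, rfl⟩ := (h _ _).1 hs
      refine ⟨n + 1, ?_, rfl⟩
      intro i hi
      rcases Nat.lt_succ_iff_lt_or_eq.1 hi with hi | rfl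
      · exact hn i hi
      · exact h1
  · rintro ⟨n, hn, rfl⟩
    induction n with
    | zero => exact ReflTransGen.refl
    | succ n ih =>
      exact (ih fun i hi => hn i (by omega)).tail ((h _ _).2 ⟨hn n (by omega), rfl⟩)

theorem Rz.inc (r : ℕ) : Rz (fun c c' : Cfg Sig => c' = (update c.1 r (c.1 r + 1), c.2)) :=
  Rz.ins (.inc r)

theorem Rz.dec (r : ℕ) :
    Rz (fun c c' : Cfg Sig => c.1 r ≠ 0 ∧ c' = (update c.1 r (c.1 r - 1), c.2)) :=
  Rz.ins (.dec r)

theorem Rz.zero (r : ℕ) : Rz (fun c c' : Cfg Sig => c.1 r = 0 ∧ c' = c) :=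
  Rz.ins (.zero r)

theorem Rz.nop : Rz (fun c c' : Cfg Sig => c' = c) :=
  Rz.ins .nop

theorem Rz.clear (r : ℕ) : Rz (fun c c' : Cfg Sig => c' = (update c.1 r 0, c.2)) := by
  refine ((Rz.dec r).star.seq (Rz.zero r)).congr ?_
  rintro ⟨s, l⟩ c'
  have h := star_iff (R := fun c c' : Cfg Sig => c.1 r ≠ 0 ∧ c' = (update c.1 r (c.1 r - 1), c.2))
    (fun i => ((update s r (s r - i), l) : Cfg Sig)) (fun i => i < s r)
    (by
      intro i c'
      simp only [update_self, update_idem]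
      refine and_congr (by omega) ?_
      rw [Nat.sub_sub])
  simp only [Nat.sub_zero, update_eq_self] at h
  simp only [Comp, h]
  constructor
  · rintro ⟨b, ⟨n, hn, rfl⟩, hb, rfl⟩
    simp only [update_self] at hb
    simp [hb]
  · rintro rfl
    exact ⟨_, ⟨s r, fun i hi => hi, rfl⟩, by simp, by simp⟩

/-- Move the content of `r` into `o` and `t` (adding). -/
theorem Rz.move2 (r o t : ℕ) (h1 : r ≠ o) (h2 : r ≠ t) (h3 : o ≠ t) :
    Rz (fun c c' : Cfg Sig => c' =
      (update (update (update c.1 o (c.1 o + c.1 r)) t (c.1 t + c.1 r)) r 0, c.2)) := by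
  refine ((((Rz.dec r).seq (Rz.inc o)).seq (Rz.inc t)).star.seq (Rz.zero r)).congr ?_
  rintro ⟨s, l⟩ c'
  have h := star_iff (R := Comp (Comp
      (fun c c' : Cfg Sig => c.1 r ≠ 0 ∧ c' = (update c.1 r (c.1 r - 1), c.2))
      (fun c c' : Cfg Sig => c' = (update c.1 o (c.1 o + 1), c.2)))
      (fun c c' : Cfg Sig => c' = (update c.1 t (c.1 t + 1), c.2)))
    (fun i => ((update (update (update s o (s o + i)) t (s t + i)) r (s r - i), l) : Cfg Sig))
    (fun i => i < s r)
    (by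
      intro i c'
      simp only [Comp]
      constructor
      · rintro ⟨b, ⟨d, ⟨hd, rfl⟩, rfl⟩, rfl⟩
        simp only [update_self] at hd
        refine ⟨by omega, ?_⟩
        refine Prod.ext ?_ rfl
        funext x
        simp only [update_apply]
        grind
      · rintro ⟨hi, rfl⟩
        refine ⟨_, ⟨_, ⟨?_, rfl⟩, rfl⟩, ?_⟩
        · simp only [update_self]; omega
        · refine Prod.ext ?_ rfl
          funext x
          simp only [update_apply]
          grind)
  have e0 : (update (update (update s o (s o + 0)) t (s t + 0)) r (s r - 0)) = s := by
    simp
  rw [e0] at h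
  simp only [Comp] at h ⊢
  simp only [h]
  constructor
  · rintro ⟨b, ⟨n, hn, rfl⟩, hb, rfl⟩
    simp only [update_self] at hb
    have hn' : n = s r := by
      have : ¬ s r < n := fun hlt => absurd (hn _ hlt) (lt_irrefl _)
      omega
    subst hn'
    simp
  · rintro rfl
    exact ⟨_, ⟨s r, fun i hi => hi, rfl⟩, by simp, by simp⟩

/-- Move the content of `r` into `o` (adding). -/
theorem Rz.move (r o : ℕ) (h1 : r ≠ o) :
    Rz (fun c c' : Cfg Sig => c' = (update (update c.1 o (c.1 o + c.1 r)) r 0, c.2)) := by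
  refine (((Rz.dec r).seq (Rz.inc o)).star.seq (Rz.zero r)).congr ?_
  rintro ⟨s, l⟩ c'
  have h := star_iff (R := (Comp
      (fun c c' : Cfg Sig => c.1 r ≠ 0 ∧ c' = (update c.1 r (c.1 r - 1), c.2))
      (fun c c' : Cfg Sig => c' = (update c.1 o (c.1 o + 1), c.2))))
    (fun i => ((update (update s o (s o + i)) r (s r - i), l) : Cfg Sig))
    (fun i => i < s r)
    (by
      intro i c'
      simp only [Comp]
      constructor
      · rintro ⟨d, ⟨hd, rfl⟩, rfl⟩
        simp only [update_self] at hd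
        refine ⟨by omega, ?_⟩
        refine Prod.ext ?_ rfl
        funext x
        simp only [update_apply]
        grind
      · rintro ⟨hi, rfl⟩
        refine ⟨_, ⟨?_, rfl⟩, ?_⟩
        · simp only [update_self]; omega
        · refine Prod.ext ?_ rfl
          funext x
          simp only [update_apply]
          grind)
  have e0 : (update (update s o (s o + 0)) r (s r - 0)) = s := by
    simp
  rw [e0] at h
  simp only [Comp] at h ⊢
  simp only [h]
  constructor
  · rintro ⟨b, ⟨n, hn, rfl⟩, hb, rfl⟩
    simp only [update_self] at hb
    have hn' : n = s r := by
      have : ¬ s r < n := fun hlt => absurd (hn _ hlt) (lt_irrefl _)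
      omega
    subst hn'
    simp
  · rintro rfl
    exact ⟨_, ⟨s r, fun i hi => hi, rfl⟩, by simp, by simp⟩

/-- Composition of total programs. -/
theorem Rz.fseq {F G : Cfg Sig → Cfg Sig} (hF : Rz (fun c c' => c' = F c))
    (hG : Rz (fun c c' => c' = G c)) : Rz (fun c c' => c' = G (F c)) :=
  (hF.seq hG).congr (by simp [Comp])

theorem Rz.fcongr {F G : Cfg Sig → Cfg Sig} (hF : Rz (fun c c' => c' = F c))
    (h : ∀ c, F c = G c) : Rz (fun c c' => c' = G c) :=
  hF.congr (by simp [h])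

/-- Copy `r` into `o`, with scratch register `t`. -/
theorem Rz.copy (r o t : ℕ) (h1 : r ≠ o) (h2 : r ≠ t) (h3 : o ≠ t) :
    Rz (fun c c' : Cfg Sig => c' = (update (update c.1 t 0) o (c.1 r), c.2)) := by
  refine ((((Rz.clear o).fseq (Rz.clear t)).fseq (Rz.move2 r o t h1 h2 h3)).fseq
    (Rz.move t r h2.symm)).fcongr ?_
  rintro ⟨s, l⟩
  refine Prod.ext ?_ rfl
  funext x
  simp only [update_apply]
  grind

theorem Rz.clearRange (k n : ℕ) :
    Rz (fun c c' : Cfg Sig => c' = (fun r => if k ≤ r ∧ r < k + n then 0 else c.1 r, c.2)) := by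
  induction n with
  | zero =>
    refine Rz.nop.fcongr ?_
    rintro ⟨s, l⟩
    refine Prod.ext ?_ rfl
    funext x
    simp only
    grind
  | succ n ih =>
    refine (ih.fseq (Rz.clear (k + n))).fcongr ?_
    rintro ⟨s, l⟩
    refine Prod.ext ?_ rfl
    funext x
    simp only [update_apply]
    grind

def Cmp (Sig : Type) {n : ℕ} (f : List.Vector ℕ n →. ℕ) : Prop :=
  ∀ (inp : Fin n → ℕ) (k : ℕ), (∀ i, inp i < k) →
    ∃ R : Cfg Sig → Cfg Sig → Prop, Rz R ∧ ∀ s l c', (∀ r, k ≤ r → s r = 0) →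
      (R (s, l) c' ↔ ∃ y ∈ f (List.Vector.ofFn fun i => s (inp i)), c' = (update s k y, l))

theorem mem_mOfFn {n : ℕ} (p : Fin n → Part ℕ) (y : List.Vector ℕ n) :
    y ∈ List.Vector.mOfFn p ↔ ∀ i, y.get i ∈ p i := by
  induction n with
  | zero =>
    simp [List.Vector.mOfFn, List.Vector.eq_nil y]
  | succ n ih =>
    simp only [List.Vector.mOfFn, Part.bind_eq_bind, Part.mem_bind_iff, Part.pure_eq_some,
      Part.mem_some_iff, ih]
    constructor
    · rintro ⟨a, ha, v, hv, rfl⟩ i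
      refine Fin.cases ?_ (fun i => ?_) i
      · simpa using ha
      · simpa using hv i
    · intro h
      refine ⟨y.head, by simpa using h 0, y.tail, fun i => ?_, by simp⟩
      simpa [List.Vector.get_tail_succ] using h i.succ

theorem Cmp.args {m n : ℕ} (g : Fin n → List.Vector ℕ m →. ℕ) (hg : ∀ i, Cmp Sig (g i))
    (inp : Fin m → ℕ) (k : ℕ) (hk : ∀ i, inp i < k) :
    ∃ R : Cfg Sig → Cfg Sig → Prop, Rz R ∧ ∀ s l c', (∀ r, k ≤ r → s r = 0) →
      (R (s, l) c' ↔ ∃ ys ∈ List.Vector.mOfFn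
          (fun i => g i (List.Vector.ofFn fun i => s (inp i))),
        c' = (fun r => if r < k then s r else ys.toList.getD (r - k) 0, l)) := by
  induction n generalizing k with
  | zero =>
    refine ⟨_, Rz.nop, fun s l c' hs => ?_⟩
    simp only [mem_mOfFn]
    constructor
    · rintro rfl
      refine ⟨List.Vector.nil, fun i => i.elim0, ?_⟩
      refine Prod.ext ?_ rfl
      funext x
      simp
      intro h
      exact hs _ h
    · rintro ⟨ys, -, rfl⟩
      refine Prod.ext ?_ rfl
      funext x
      simp [List.Vector.eq_nil ys]
      intro h
      exact (hs _ h).symm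
  | succ n ih =>
    obtain ⟨R₁, z₁, h₁⟩ := hg 0 inp k hk
    obtain ⟨R₂, z₂, h₂⟩ := ih (fun i => g i.succ) (fun i => hg _) (k + 1)
      (fun i => (hk i).trans (Nat.lt_succ_self _))
    refine ⟨_, z₁.seq z₂, fun s l c' hs => ?_⟩
    have aux : ∀ y, (fun i => update s k y (inp i)) = fun i => s (inp i) := by
      intro y; funext i
      exact update_of_ne (hk i).ne _ _
    have aux2 : ∀ (y : ℕ) (ys : List.Vector ℕ n),
        (fun r => if r < k + 1 then update s k y r else ys.toList.getD (r - (k + 1)) 0)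
        = (fun r => if r < k then s r else (y ::ᵥ ys).toList.getD (r - k) 0) := by
      intro y ys
      funext r
      rcases lt_trichotomy r k with h | rfl | h
      · simp [h, h.ne, Nat.lt_succ_of_lt h]
      · simp
      · obtain ⟨d, rfl⟩ := Nat.exists_eq_add_of_lt h
        have e1 : k + d + 1 - (k + 1) = d := by omega
        have e2 : k + d + 1 - k = d + 1 := by omega
        have e3 : ¬ (k + d + 1 < k + 1) := by omega
        have e4 : ¬ (k + d + 1 < k) := by omega
        simp [e1, e2, e3, e4]
    have hz : ∀ y r, k + 1 ≤ r → update s k y r = 0 := by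
      intro y r hr
      rw [update_of_ne (by omega)]
      exact hs r (by omega)
    simp only [Comp, List.Vector.mOfFn, Part.bind_eq_bind, Part.mem_bind_iff, Part.pure_eq_some,
      Part.mem_some_iff]
    constructor
    · rintro ⟨b, hb, hc⟩
      obtain ⟨y, hy, rfl⟩ := (h₁ _ _ _ hs).1 hb
      obtain ⟨ys, hys, rfl⟩ := (h₂ _ _ _ (hz y)).1 hc
      rw [aux] at hys
      exact ⟨y ::ᵥ ys, ⟨y, hy, ys, hys, rfl⟩, by rw [aux2]⟩
    · rintro ⟨_, ⟨y, hy, ys, hys, rfl⟩, rfl⟩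
      refine ⟨_, (h₁ _ _ _ hs).2 ⟨y, hy, rfl⟩, (h₂ _ _ _ (hz y)).2 ⟨ys, ?_, ?_⟩⟩
      · rw [aux]; exact hys
      · rw [aux2]

theorem Cmp.comp {m n : ℕ} {f : List.Vector ℕ n →. ℕ} (g : Fin n → List.Vector ℕ m →. ℕ)
    (hf : Cmp Sig f) (hg : ∀ i, Cmp Sig (g i)) :
    Cmp Sig (fun v => (List.Vector.mOfFn fun i => g i v) >>= f) := by
  intro inp k hk
  obtain ⟨R₁, z₁, h₁⟩ := Cmp.args g hg inp (k + 1) (fun i => (hk i).trans (Nat.lt_succ_self _))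
  obtain ⟨R₂, z₂, h₂⟩ := hf (fun i => k + 1 + i) (k + 1 + n) (by simp)
  refine ⟨_, (z₁.seq z₂).seq ((Rz.move (k + 1 + n) k (by omega)).fseq
    (Rz.clearRange (k + 1) n)), fun s l c' hs => ?_⟩
  have hs1 : ∀ r, k + 1 ≤ r → s r = 0 := fun r hr => hs r (by omega)
  have hz : ∀ ys : List.Vector ℕ n, ∀ r, k + 1 + n ≤ r →
      (if r < k + 1 then s r else ys.toList.getD (r - (k + 1)) 0) = 0 := by
    intro ys r hr
    rw [if_neg (by omega), List.getD_eq_default]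
    simp; omega
  have aux : ∀ ys : List.Vector ℕ n, (List.Vector.ofFn fun i : Fin n =>
      (if k + 1 + (i : ℕ) < k + 1 then s (k + 1 + i) else
        ys.toList.getD (k + 1 + i - (k + 1)) 0)) = ys := by
    intro ys
    ext i
    have e1 : ¬ (k + 1 + (i : ℕ) < k + 1) := by omega
    have e2 : k + 1 + (i : ℕ) - (k + 1) = i := by omega
    rw [List.Vector.get_ofFn, if_neg e1, e2, List.getD_eq_getElem _ _ (by simp)]
    rfl
  have aux2 : ∀ (ys : List.Vector ℕ n) (y : ℕ),
      ((fun r => if k + 1 ≤ r ∧ r < k + 1 + n then 0 else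
        update (update (update (fun r => if r < k + 1 then s r else
          ys.toList.getD (r - (k + 1)) 0) (k + 1 + n) y) k
          (update (fun r => if r < k + 1 then s r else
          ys.toList.getD (r - (k + 1)) 0) (k + 1 + n) y k +
          update (fun r => if r < k + 1 then s r else
          ys.toList.getD (r - (k + 1)) 0) (k + 1 + n) y (k + 1 + n))) (k + 1 + n) 0 r) : ℕ → ℕ)
        = update s k y := by
    intro ys y
    funext r
    have h0 := hs k le_rfl
    have h1 := hs1 r
    have h2 := hz ys r
    simp only [update_apply]
    grind
  simp only [Comp]
  constructor
  · rintro ⟨b, ⟨d, hd, hb⟩, rfl⟩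
    obtain ⟨ys, hys, rfl⟩ := (h₁ _ _ _ hs1).1 hd
    obtain ⟨y, hy, rfl⟩ := (h₂ _ _ _ (hz ys)).1 hb
    rw [aux] at hy
    exact ⟨y, Part.mem_bind_iff.2 ⟨ys, hys, hy⟩, Prod.ext (aux2 ys y) rfl⟩
  · rintro ⟨y, hyy, rfl⟩
    obtain ⟨ys, hys, hy⟩ := Part.mem_bind_iff.1 hyy
    refine ⟨_, ⟨_, (h₁ _ _ _ hs1).2 ⟨ys, hys, rfl⟩, (h₂ _ _ _ (hz ys)).2 ⟨y, ?_, rfl⟩⟩, ?_⟩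
    · rw [aux]; exact hy
    · exact Prod.ext (aux2 ys y).symm rfl

theorem Cmp.zero : Cmp Sig (fun _ : List.Vector ℕ 0 => Part.some 0) := by
  intro inp k hk
  refine ⟨_, Rz.nop, fun s l c' hs => ?_⟩
  have e : update s k 0 = s := by rw [← hs k le_rfl]; simp
  simp [e]

theorem Cmp.get {n : ℕ} (i : Fin n) : Cmp Sig (fun v : List.Vector ℕ n => Part.some (v.get i)) := by
  intro inp k hk
  have hi := hk i
  refine ⟨_, Rz.copy (inp i) k (k + 1) (by omega) (by omega) (by omega), fun s l c' hs => ?_⟩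
  have e : update s (k + 1) 0 = s := by rw [← hs (k + 1) (by omega)]; simp
  simp [e]

theorem Cmp.succ : Cmp Sig (fun v : List.Vector ℕ 1 => Part.some (Nat.succ v.head)) := by
  intro inp k hk
  have hi := hk 0
  refine ⟨_, (Rz.copy (inp 0) k (k + 1) (by omega) (by omega) (by omega)).fseq (Rz.inc k),
    fun s l c' hs => ?_⟩
  have e : update s (k + 1) 0 = s := by rw [← hs (k + 1) (by omega)]; simp
  simp [e]

theorem Cmp.prec {n : ℕ} {f : List.Vector ℕ n → ℕ} {g : List.Vector ℕ (n + 2) → ℕ}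
    (hf : Cmp Sig (fun v => Part.some (f v))) (hg : Cmp Sig (fun v => Part.some (g v))) :
    Cmp Sig (fun v : List.Vector ℕ (n + 1) => Part.some
      (v.head.rec (f v.tail) fun y IH => g (y ::ᵥ IH ::ᵥ v.tail) : ℕ)) := by
  intro inp k hk
  have h0 := hk 0
  obtain ⟨R₁, z₁, h₁⟩ := hf (fun i => inp i.succ) k (fun i => hk _)
  obtain ⟨R₂, z₂, h₂⟩ := hg
    (fun i => Fin.cases (k + 1) (fun i => Fin.cases k (fun i => inp i.succ) i) i) (k + 3) (by
      intro i
      refine Fin.cases ?_ (fun i => Fin.cases ?_ (fun i => ?_) i) i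
      · show k + 1 < k + 3
        omega
      · show k < k + 3
        omega
      · have := hk i.succ
        show inp i.succ < k + 3
        omega)
  have zt : Rz (fun c c' : Cfg Sig => c' = (update (update (update c.1 k (c.1 (k + 3))) (k + 3) 0)
      (k + 1) (c.1 (k + 1) + 1), c.2)) := by
    refine (((Rz.clear k).fseq (Rz.move (k + 3) k (by omega))).fseq (Rz.inc (k + 1))).fcongr ?_
    rintro ⟨s, l⟩
    refine Prod.ext ?_ rfl
    funext x
    simp only [update_apply]
    grind
  have zb := ((Rz.dec (Sig := Sig) (k + 2)).seq z₂).seq zt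
  refine ⟨_, (z₁.seq (Rz.copy (inp 0) (k + 2) (k + 3) (by omega) (by omega) (by omega))).seq
    ((zb.star.seq (Rz.zero (k + 2))).seq (Rz.clear (k + 1))), fun s l c' hs => ?_⟩
  set v : List.Vector ℕ n := List.Vector.ofFn fun i => s (inp i.succ) with hv
  set I : ℕ → ℕ := fun m => (m.rec (f v) fun y IH => g (y ::ᵥ IH ::ᵥ v) : ℕ) with hI
  have hI1 : ∀ m, I (m + 1) = g (m ::ᵥ I m ::ᵥ v) := fun m => rfl
  have hI0 : I 0 = f v := rfl
  clear_value I
  have hv' : (List.Vector.ofFn fun i => s (inp i)) = s (inp 0) ::ᵥ v := by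
    rw [hv]; rfl
  let c : ℕ → Cfg Sig := fun i =>
    (update (update (update s k (I i)) (k + 1) i) (k + 2) (s (inp 0) - i), l)
  have h₂' : ∀ i c', i < s (inp 0) → (R₂ (update (update (update s k (I i)) (k + 1) i) (k + 2)
      (s (inp 0) - i - 1), l) c' ↔
      c' = (update (update (update (update s k (I i)) (k + 1) i) (k + 2)
        (s (inp 0) - i - 1)) (k + 3) (I (i + 1)), l)) := by
    intro i c' hi
    rw [h₂ _ _ _ (by
      intro r hr
      rw [update_of_ne (by omega), update_of_ne (by omega), update_of_ne (by omega)]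
      exact hs r (by omega))]
    have e : (List.Vector.ofFn fun j : Fin (n + 2) =>
        update (update (update s k (I i)) (k + 1) i) (k + 2) (s (inp 0) - i - 1)
        (Fin.cases (k + 1) (fun i => Fin.cases k (fun i => inp i.succ) i) j : ℕ))
        = i ::ᵥ I i ::ᵥ v := by
      ext j
      rw [List.Vector.get_ofFn]
      refine Fin.cases ?_ (fun j => Fin.cases ?_ (fun j => ?_) j) j
      · show update (update (update s k (I i)) (k + 1) i) (k + 2) (s (inp 0) - i - 1) (k + 1) = i
        simp
      · show update (update (update s k (I i)) (k + 1) i) (k + 2) (s (inp 0) - i - 1) k = I i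
        simp
      · have := hk j.succ
        show update (update (update s k (I i)) (k + 1) i) (k + 2) (s (inp 0) - i - 1)
          (inp j.succ) = v.get j
        rw [update_of_ne (by omega), update_of_ne (by omega), update_of_ne (by omega), hv,
          List.Vector.get_ofFn]
    rw [e, hI1]
    simp
  have hst := star_iff
    (R := Comp (Comp
      (fun c c' : Cfg Sig => c.1 (k + 2) ≠ 0 ∧
        c' = (update c.1 (k + 2) (c.1 (k + 2) - 1), c.2)) R₂)
      (fun c c' : Cfg Sig => c' = (update (update (update c.1 k (c.1 (k + 3))) (k + 3) 0)
      (k + 1) (c.1 (k + 1) + 1), c.2))) c (fun i => i < s (inp 0)) (by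
    intro i c'
    have e : ∀ i, update (update (update (update (update (update (update s k (I i)) (k + 1) i)
        (k + 2) (s (inp 0) - i - 1)) (k + 3) (I (i + 1))) k (I (i + 1))) (k + 3) 0) (k + 1) (i + 1)
        = update (update (update s k (I (i + 1))) (k + 1) (i + 1)) (k + 2)
          (s (inp 0) - (i + 1)) := by
      intro i
      funext r
      have := hs (k + 3) (by omega)
      simp only [update_apply]
      grind
    simp only [Comp, c]
    constructor
    · rintro ⟨b, ⟨d, ⟨hd, rfl⟩, hb⟩, rfl⟩
      simp only [update_self, update_idem] at hd hb
      have hi : i < s (inp 0) := by omega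
      obtain rfl := (h₂' i _ hi).1 hb
      refine ⟨hi, ?_⟩
      rw [← e]
      simp
    · rintro ⟨hi, rfl⟩
      have h5 := (h₂' i _ hi).2 rfl
      refine ⟨(update (update (update (update s k (I i)) (k + 1) i) (k + 2)
          (s (inp 0) - i - 1)) (k + 3) (I (i + 1)), l), ⟨_, ⟨?_, rfl⟩, ?_⟩, ?_⟩
      · simp only [update_self]
        omega
      · simp only [update_self, update_idem]
        exact h5
      · rw [← e]
        simp)
  have e0 : (update (update (update s k (I 0)) (k + 3) 0) (k + 2) (update s k (I 0) (inp 0)), l)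
      = c 0 := by
    refine Prod.ext ?_ rfl
    funext r
    have h3 := hs (k + 3) (by omega)
    have h1 := hs (k + 1) (by omega)
    simp only [update_apply, c]
    grind
  have e1 : update (update (update (update s k (I (s (inp 0)))) (k + 1) (s (inp 0))) (k + 2)
      (s (inp 0) - s (inp 0))) (k + 1) 0 = update s k (I (s (inp 0))) := by
    funext r
    have h3 := hs (k + 2) (by omega)
    have h1 := hs (k + 1) (by omega)
    simp only [update_apply]
    grind
  have h₁' : ∀ c', R₁ (s, l) c' ↔ c' = (update s k (I 0), l) := by
    intro c'
    rw [h₁ _ _ _ hs, hI0]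
    simp [hv]
  have hR : (∃ y ∈ Part.some (Nat.rec (f (List.Vector.ofFn fun i => s (inp i)).tail)
      (fun y IH => g (y ::ᵥ IH ::ᵥ (List.Vector.ofFn fun i => s (inp i)).tail))
      (List.Vector.ofFn fun i => s (inp i)).head : ℕ), c' = (update s k y, l)) ↔
      c' = (update s k (I (s (inp 0))), l) := by
    rw [hv', hI]
    simp
  refine Iff.trans ?_ hR.symm
  constructor
  · rintro ⟨b, ⟨d, hd, rfl⟩, a, ⟨a', ha', h0, rfl⟩, rfl⟩
    obtain rfl := (h₁' _).1 hd
    simp only [e0] at ha'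
    obtain ⟨m, hm, rfl⟩ := (hst _).1 ha'
    simp only [c, update_self] at h0
    have hm' : m = s (inp 0) := by
      have : ¬ s (inp 0) < m := fun hlt => absurd (hm _ hlt) (lt_irrefl _)
      omega
    subst hm'
    exact Prod.ext e1 rfl
  · rintro rfl
    refine ⟨_, ⟨_, (h₁' _).2 rfl, rfl⟩, c (s (inp 0)), ⟨_, ?_, ?_, rfl⟩, ?_⟩
    · simp only [e0]
      exact (hst _).2 ⟨s (inp 0), fun i hi => hi, rfl⟩
    · simp [c]
    · exact Prod.ext e1.symm rfl

theorem Cmp.rfind {n : ℕ} {f : List.Vector ℕ (n + 1) → ℕ}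
    (hf : Cmp Sig (fun v => Part.some (f v))) :
    Cmp Sig (fun v => Nat.rfind fun n => (Part.some (decide (f (n ::ᵥ v) = 0)))) := by
  intro inp k hk
  obtain ⟨R₁, z₁, h₁⟩ := hf (fun i => Fin.cases k inp i) (k + 1) (by
      intro i
      refine Fin.cases ?_ (fun i => ?_) i
      · simp
      · have := hk i
        simp; omega)
  have zt : Rz (fun c c' : Cfg Sig => c' = (update (update c.1 (k + 1) 0) k (c.1 k + 1),
      c.2)) := by
    refine ((Rz.clear (k + 1)).fseq (Rz.inc k)).fcongr ?_
    rintro ⟨s, l⟩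
    refine Prod.ext ?_ rfl
    funext x
    simp only [update_apply]
    grind
  have zb := ((z₁.seq (Rz.dec (Sig := Sig) (k + 1))).seq zt)
  refine ⟨_, zb.star.seq (z₁.seq (Rz.zero (k + 1))), fun s l c' hs => ?_⟩
  set v : List.Vector ℕ n := List.Vector.ofFn fun i => s (inp i) with hv
  have h₁' : ∀ i c', R₁ (update s k i, l) c' ↔
      c' = (update (update s k i) (k + 1) (f (i ::ᵥ v)), l) := by
    intro i c'
    rw [h₁ _ _ _ (by
      intro r hr
      rw [update_of_ne (by omega)]
      exact hs r (by omega))]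
    have e : (List.Vector.ofFn fun j : Fin (n + 1) =>
        update s k i (Fin.cases k inp j : ℕ)) = i ::ᵥ v := by
      ext j
      refine Fin.cases ?_ (fun j => ?_) j
      · simp
      · have := hk j
        simp [hv, update_of_ne this.ne]
    rw [e]
    simp
  have hst := star_iff (fun i => ((update s k i, l) : Cfg Sig)) (fun i => f (i ::ᵥ v) ≠ 0)
    (R := Comp (Comp R₁ (fun c c' : Cfg Sig => c.1 (k + 1) ≠ 0 ∧
        c' = (update c.1 (k + 1) (c.1 (k + 1) - 1), c.2)))
      (fun c c' : Cfg Sig => c' = (update (update c.1 (k + 1) 0) k (c.1 k + 1), c.2))) (by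
    intro i c'
    simp only [Comp]
    constructor
    · rintro ⟨b, ⟨d, hd, h0, rfl⟩, rfl⟩
      obtain rfl := (h₁' _ _).1 hd
      simp only [update_self] at h0
      refine ⟨h0, Prod.ext ?_ rfl⟩
      funext r
      have := hs (k + 1) (by omega)
      simp only [update_apply]
      grind
    · rintro ⟨h0, rfl⟩
      refine ⟨_, ⟨_, (h₁' _ _).2 rfl, by simpa using h0, rfl⟩, Prod.ext ?_ rfl⟩
      funext r
      have := hs (k + 1) (by omega)
      simp only [update_apply]
      grind)
  have e0 : update s k 0 = s := by rw [← hs k le_rfl]; simp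
  rw [e0] at hst
  have e1 : ∀ i, update (update s k i) (k + 1) 0 = update s k i := by
    intro i
    funext r
    have := hs (k + 1) (by omega)
    simp only [update_apply]
    grind
  have hr : ∀ y, y ∈ (Nat.rfind fun n => (Part.some (decide (f (n ::ᵥ v) = 0)))) ↔
      f (y ::ᵥ v) = 0 ∧ ∀ i < y, f (i ::ᵥ v) ≠ 0 := by
    intro y
    refine Nat.mem_rfind.trans ?_
    simp
  simp only [hr]
  constructor
  · rintro ⟨b, hb, d, hd, h0, rfl⟩
    obtain ⟨m, hm, rfl⟩ := (hst _).1 hb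
    obtain rfl := (h₁' _ _).1 hd
    simp only [update_self] at h0
    refine ⟨m, ⟨h0, hm⟩, ?_⟩
    rw [h0, e1]
  · rintro ⟨m, ⟨h0, hm⟩, rfl⟩
    refine ⟨_, (hst _).2 ⟨m, hm, rfl⟩, _, (h₁' _ _).2 rfl, by simpa using h0, ?_⟩
    rw [h0, e1]

theorem Cmp.prim {n : ℕ} {f : List.Vector ℕ n → ℕ} (hf : Nat.Primrec' f) :
    Cmp Sig (fun v => Part.some (f v)) := by
  induction hf with
  | zero => exact Cmp.zero
  | succ => exact Cmp.succ
  | get i => exact Cmp.get i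
  | comp g _ _ hf hg =>
    have := Cmp.comp _ hf hg
    simp only [← Part.pure_eq_some, List.Vector.mOfFn_pure, pure_bind] at this
    simpa using this
  | prec _ _ hf hg => exact Cmp.prec hf hg

theorem Cmp.part {n : ℕ} {f : List.Vector ℕ n →. ℕ} (hf : Nat.Partrec' f) :
    Cmp Sig f := by
  induction hf with
  | prim h => exact Cmp.prim h
  | comp g _ _ hf hg => exact Cmp.comp g hf hg
  | rfind _ hf => exact Cmp.rfind hf


abbrev reg0 (m : ℕ) : ℕ → ℕ := update (fun _ => 0) 0 m

theorem Rz.upd {u : ℕ → ℕ} (hu : Computable u) (a : Sig) :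
    ∃ R : Cfg Sig → Cfg Sig → Prop, Rz R ∧ ∀ m l c',
      (R (reg0 m, l) c' ↔ c' = (reg0 (u m), l ++ [a])) := by
  have h1 : Nat.Partrec' (fun v : List.Vector ℕ 1 => Part.some (u v.head)) :=
    Nat.Partrec'.part_iff₁ (f := fun n => Part.some (u n)) |>.2 hu
  obtain ⟨R, zR, hR⟩ := Cmp.part (Sig := Sig) h1 (fun _ => 0) 1 (by simp)
  refine ⟨_, (zR.seq ((Rz.clear 0).fseq (Rz.move 1 0 (by omega)))).seq (Rz.ins (.out a)),
    fun m l c' => ?_⟩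
  have hR' := fun c' => hR (reg0 m) l c' (by
    intro r hr
    rw [reg0, update_of_ne (by omega)])
  have e : update (update (update (reg0 m) 1 (u m)) 0 (u m)) 1 0 =
      reg0 (u m) := by
    funext r
    simp only [update_apply]
    grind
  constructor
  · rintro ⟨b, ⟨d, hd, rfl⟩, hb⟩
    rw [hR'] at hd
    obtain ⟨y, hy, rfl⟩ := hd
    simp only [Part.mem_some_iff] at hy
    subst hy
    simp only [Ins.act] at hb
    subst hb
    simpa using e
  · rintro rfl
    refine ⟨_, ⟨_, (hR' _).2 ⟨_, Part.mem_some _, rfl⟩, rfl⟩, ?_⟩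
    simp only [Ins.act]
    simpa using e.symm

theorem lang_rz [Fintype Sig] [Primcodable Sig] (L : Language Sig)
    (hL : REPred fun x => x ∈ L) :
    ∃ R : Cfg Sig → Cfg Sig → Prop, Rz R ∧ ∀ x, x ∈ L ↔ ∃ s', R (fun _ => 0, []) (s', x) := by
  have hu : ∀ a : Sig, Computable (fun n : ℕ =>
      Encodable.encode (((Encodable.decode n : Option (List Sig)).getD []) ++ [a])) := by
    intro a
    refine Computable.encode.comp (Primrec.to_comp ?_)
    exact Primrec.list_append.comp
      (Primrec.option_getD.comp Primrec.decode (Primrec.const [])) (Primrec.const [a])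
  choose RU zU hU using fun a => Rz.upd (Sig := Sig) (hu a) a
  have h1 : Nat.Partrec' (fun v : List.Vector ℕ 1 =>
      (fun n : ℕ => (Part.assert (((Encodable.decode n : Option (List Sig)).getD []) ∈ L)
        (fun _ => Part.some 0))) v.head) := by
    refine (Nat.Partrec'.part_iff₁ (f := fun n : ℕ =>
      (Part.assert (((Encodable.decode n : Option (List Sig)).getD []) ∈ L)
        (fun _ => Part.some 0)))).2 ?_
    have h2 : Computable (fun n : ℕ => (Encodable.decode n : Option (List Sig)).getD []) :=
      Primrec.to_comp (Primrec.option_getD.comp Primrec.decode (Primrec.const []))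
    have h3 := Partrec.comp hL h2
    have h4 := Partrec.map h3 (g := fun _ _ => 0) (Computable.const 0).to₂
    refine h4.of_eq ?_
    intro n
    ext y
    simp [eq_comm]
  obtain ⟨RF, zF, hF⟩ := Cmp.part (Sig := Sig) h1 (fun _ => 0) 1 (by simp)
  have hF' := fun m l c' => hF (reg0 m) l c' (by
    intro r hr
    rw [reg0, update_of_ne (by omega)])
  refine ⟨_, (Rz.exists_fin zU).star.seq zF, fun x => ?_⟩
  have inv : ∀ c', ReflTransGen (fun c c' => ∃ a, RU a c c') (fun _ => 0, []) c' →
      c' = (reg0 (Encodable.encode c'.2), c'.2) := by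
    intro c' h
    induction h with
    | refl =>
      refine Prod.ext ?_ rfl
      funext r
      simp [update_apply]
    | tail _ h ih =>
      obtain ⟨a, ha⟩ := h
      rw [ih, hU] at ha
      subst ha
      simp
  have reach : ∀ l : List Sig, ReflTransGen (fun c c' => ∃ a, RU a c c') (fun _ => 0, [])
      (reg0 (Encodable.encode l), l) := by
    intro l
    induction l using List.reverseRecOn with
    | nil =>
      have e : (reg0 (Encodable.encode ([] : List Sig)) : ℕ → ℕ) = fun _ => 0 := by
        funext r
        simp [update_apply]
      rw [e]
    | append_singleton l a ih =>
      refine ih.tail ⟨a, (hU _ _ _ _).2 ?_⟩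
      simp
  constructor
  · intro hx
    refine ⟨_, _, reach x, (hF' _ _ _).2 ⟨0, ?_, rfl⟩⟩
    simpa using hx
  · rintro ⟨s', b, hb, h⟩
    rw [inv b hb, hF'] at h
    obtain ⟨y, hy, he⟩ := h
    have : x = b.2 := congrArg Prod.snd he
    subst this
    simp at hy
    exact hy.1

/-! ### The grammar/observer system simulating a machine -/

def Ins.reg : Ins Sig → ℕ
  | .nop => 0
  | .inc r => r
  | .dec r => r
  | .zero r => r
  | .out _ => 0

section Sim

variable (M : Mach Sig) (N : ℕ) [NeZero N]

abbrev fr (r : ℕ) : Fin N := Fin.ofNat N r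

abbrev BV := Fin N → ZMod 3

abbrev Ctl := (M.Q ⊕ M.E) × BV N

abbrev NTm := Ctl M N ⊕ Fin N

abbrev Sym := Symbol (Fin N) (NTm M N)

/-- abstract states -/
abbrev AS := Option (Ctl M N) × BV N × (Fin N → ℕ)

def nbI (b : BV N) : Ins Sig → BV N
  | .dec r => b + Pi.single (fr N r) 1
  | _ => b

def icI : Ins Sig → Option (Fin N)
  | .inc r => some (fr N r)
  | _ => none

def icV (o : Option (Fin N)) : Fin N → ℕ := o.elim 0 (fun r => Pi.single r 1)

inductive TS : AS M N → AS M N → Prop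
  | sel (e : M.E) (b d : BV N) (n : Fin N → ℕ) :
      TS (some (.inl e.1.1, b), d, n) (some (.inr e, b), d, n)
  | ex (e : M.E) (b d : BV N) (n : Fin N → ℕ) :
      TS (some (.inr e, b), d, n) (some (.inl e.1.2.2, nbI N b e.1.2.1), d,
        n + icV N (icI N e.1.2.1))
  | halt (b d : BV N) (n : Fin N → ℕ) :
      TS (some (.inl M.ha, b), d, n) (none, d, n)
  | conv (κ : Option (Ctl M N)) (d : BV N) (n : Fin N → ℕ) (r : Fin N) :
      TS (κ, d, n + Pi.single r 1) (κ, d + Pi.single r 1, n)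

def obsI (b d : BV N) (p : Fin N → Bool) : Ins Sig → Option (Option Sig)
  | .nop => if d = b then none else some none
  | .inc _ => if d = b then none else some none
  | .dec r => if d = b ∨ d = b + Pi.single (fr N r) 1 then none else some none
  | .zero r => if d = b ∧ p (fr N r) = false then none else some none
  | .out a => if d = b then some (some a) else some none

def obs : Option (Ctl M N) × BV N × (Fin N → Bool) → Option (Option Sig)
  | (none, _, _) => none
  | (some (.inl _, b), d, _) => if d = b then none else some none
  | (some (.inr e, b), d, p) => obsI N b d p e.1.2.1

def fz (σ : AS M N) : Option (Ctl M N) × BV N × (Fin N → Bool) :=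
  (σ.1, σ.2.1, fun r => decide (σ.2.2 r ≠ 0))

inductive AccS : AS M N → List Sig → Prop
  | fin (d : BV N) : AccS (none, d, 0) []
  | step (σ σ' : AS M N) (y x : List Sig) : TS M N σ σ' →
      (obs M N (fz M N σ)).toList = y.map some → AccS σ' x → AccS σ (y ++ x)

variable {N} in
theorem single_ne (r : Fin N) : (Pi.single r 1 : BV N) ≠ 0 := by
  intro h
  have := congrFun h r
  simp at this

variable {N} in
theorem single_add_ne (r r' : Fin N) : (Pi.single r 1 + Pi.single r' 1 : BV N) ≠ 0 := by
  intro h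
  have := congrFun h r
  simp only [Pi.add_apply, Pi.single_eq_same, Pi.zero_apply, Pi.single_apply] at this
  split_ifs at this
  · exact absurd this (by decide)
  · exact absurd this (by decide)

variable {N} in
theorem single_inj {r r' : Fin N} (h : (Pi.single r 1 : BV N) = Pi.single r' 1) : r = r' := by
  by_contra hne
  have := congrFun h r
  simp [hne] at this

theorem upd_add {r : ℕ} (hr : r < N) (s : ℕ → ℕ) :
    (fun i : Fin N => s i) + Pi.single (fr N r) 1 =
      fun i : Fin N => update s r (s r + 1) i := by
  funext i
  have : (i = fr N r) ↔ (i : ℕ) = r := by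
    rw [Fin.ext_iff]
    simp [Nat.mod_eq_of_lt hr]
  simp only [Pi.add_apply, Pi.single_apply, update_apply, this]
  split_ifs with h
  · rw [h]
  · simp

theorem fr_val {r : ℕ} (hr : r < N) : ((fr N r : Fin N) : ℕ) = r := by
  simp [Nat.mod_eq_of_lt hr]

def PP (σ : AS M N) (x : List Sig) : Prop :=
  match σ with
  | (none, _, _) => x = []
  | (some (.inl q, b), d, n) => d = b ∧ ∀ s : ℕ → ℕ, ∀ l, n = (fun i : Fin N => s i) →
      ∃ s', ReflTransGen M.Step (q, (s, l)) (M.ha, (s', l ++ x))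
  | (some (.inr e, b), d, n) =>
    (d = b ∧ ∀ s : ℕ → ℕ, ∀ l, n = (fun i : Fin N => s i) →
      ∃ s' c, e.1.2.1.act (s, l) c ∧
        ReflTransGen M.Step (e.1.2.2, c) (M.ha, (s', l ++ x))) ∨
    (∃ r, e.1.2.1 = .dec r ∧ d = b + Pi.single (fr N r) 1 ∧
      ∀ s : ℕ → ℕ, ∀ l, n = (fun i : Fin N => s i) →
        ∃ s', ReflTransGen M.Step (e.1.2.2, (s, l)) (M.ha, (s', l ++ x)))

theorem obsI_ok {i : Ins Sig} {b d : BV N} (p : Fin N → Bool) (hi : ∀ r, i ≠ .dec r)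
    (h : obsI N b d p i ≠ some none) : d = b := by
  by_contra hd
  cases i <;> simp_all [obsI]

theorem toList_map {o : Option (Option Sig)} {y : List Sig} (h : o.toList = y.map some) :
    (o = none ∧ y = []) ∨ ∃ a, o = some (some a) ∧ y = [a] := by
  cases o with
  | none => left; simpa using h.symm
  | some o =>
    right
    cases y with
    | nil => simp at h
    | cons a y =>
      simp at h
      exact ⟨a, by rw [h.1], by rw [h.2]⟩

variable {M N}

theorem sound (hN : ∀ e ∈ M.E, e.2.1.reg < N) {σ : AS M N} {x : List Sig}
    (h : AccS M N σ x) : PP M N σ x := by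
  induction h with
  | fin d => simp [PP]
  | step σ σ' y x ht ho _ ih =>
    cases ht with
    | sel e b d n =>
      simp only [fz, obs] at ho
      replace ho := toList_map ho
      split_ifs at ho with hd
      · simp at ho
        subst hd ho
        rcases ih with ⟨_, h⟩ | ⟨r, _, h, _⟩
        · refine ⟨rfl, fun s l hn => ?_⟩
          obtain ⟨s', c, hc, hr⟩ := h s l hn
          exact ⟨s', ReflTransGen.head ⟨_, e.2, hc⟩ hr⟩
        · exact absurd (left_eq_add.1 h) (single_ne _)
      · simp at ho
    | ex e b d n =>
      obtain ⟨⟨q, i, q'⟩, he⟩ := e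
      have hr := hN _ he
      obtain ⟨hd, h⟩ := ih
      have ho := toList_map ho
      cases i with
      | nop =>
        simp only [fz, obs, obsI] at ho
        simp only [nbI, icI, icV] at hd h
        subst hd
        simp at ho
        subst ho
        refine .inl ⟨rfl, fun s l hn => ?_⟩
        obtain ⟨s', h⟩ := h s l (by simpa using hn)
        exact ⟨s', _, rfl, h⟩
      | inc r =>
        simp only [fz, obs, obsI] at ho
        simp only [nbI, icI, icV] at hd h
        subst hd
        simp at ho
        subst ho
        refine .inl ⟨rfl, fun s l hn => ?_⟩
        obtain ⟨s', h⟩ := h (update s r (s r + 1)) l (by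
          rw [hn]; exact upd_add N hr s)
        exact ⟨s', _, rfl, h⟩
      | dec r =>
        simp only [fz, obs, obsI] at ho
        simp only [nbI, icI, icV] at hd h
        subst hd
        simp at ho
        subst ho
        exact .inr ⟨r, rfl, rfl, fun s l hn => h s l (by simpa using hn)⟩
      | zero r =>
        simp only [fz, obs, obsI] at ho
        simp only [nbI, icI, icV] at hd h
        subst hd
        split_ifs at ho with h0
        · simp at ho
          subst ho
          refine .inl ⟨rfl, fun s l hn => ?_⟩
          obtain ⟨s', h⟩ := h s l (by simpa using hn)
          refine ⟨s', _, ⟨?_, rfl⟩, h⟩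
          have h0 := h0.2
          subst hn
          simp only [ne_eq, decide_not, Bool.not_eq_false', decide_eq_true_eq] at h0
          rw [fr_val N (r := r) hr] at h0
          exact h0
        · simp at ho
      | out a =>
        simp only [fz, obs, obsI] at ho
        simp only [nbI, icI, icV] at hd h
        subst hd
        simp at ho
        subst ho
        refine .inl ⟨rfl, fun s l hn => ?_⟩
        obtain ⟨s', h⟩ := h s (l ++ [a]) (by simpa using hn)
        exact ⟨s', _, rfl, by simpa using h⟩
    | halt b d n =>
      simp only [PP] at ih
      subst ih
      simp only [fz, obs] at ho
      replace ho := toList_map ho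
      split_ifs at ho with hd
      · simp at ho
        subst hd ho
        exact ⟨rfl, fun s l _ => ⟨s, by simpa using ReflTransGen.refl⟩⟩
      · simp at ho
    | conv κ d n r =>
      have ho := toList_map ho
      rcases κ with _ | ⟨q | ⟨⟨q, i, q'⟩, he⟩, b⟩
      · simp only [fz, obs] at ho
        simp at ho
        subst ho
        simpa [PP] using ih
      · simp only [fz, obs] at ho
        split_ifs at ho with hd
        · subst hd
          exact absurd (add_eq_left.1 ih.1) (single_ne _)
        · simp at ho
      · have hr := hN _ he
        simp only [fz, obs] at ho
        by_cases hi : ∃ r', i = .dec r'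
        · obtain ⟨r', rfl⟩ := hi
          change r' < N at hr
          simp only [obsI] at ho
          split_ifs at ho with hd
          swap
          · simp at ho
          simp at ho
          subst ho
          rcases ih with ⟨h, _⟩ | ⟨r'', hi', hd', h⟩
          · exfalso
            rcases hd with rfl | rfl
            · exact single_ne _ (add_eq_left.1 h)
            · rw [add_assoc] at h
              exact single_add_ne _ _ (add_eq_left.1 h)
          · cases hi'
            rcases hd with rfl | rfl
            · obtain rfl := single_inj (add_left_cancel hd')
              refine .inl ⟨rfl, fun s l hn => ?_⟩
              have h0 : s r' ≠ 0 := by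
                have := congrFun hn (fr N r')
                simp only [Pi.add_apply, Pi.single_eq_same] at this
                rw [fr_val N hr] at this
                omega
              obtain ⟨s', h'⟩ := h (update s r' (s r' - 1)) l (by
                have h1 := upd_add N (r := r') hr (update s r' (s r' - 1))
                have h2 : update (update s r' (s r' - 1)) r'
                    (update s r' (s r' - 1) r' + 1) = s := by
                  have : s r' - 1 + 1 = s r' := by omega
                  simp [this]
                rw [h2] at h1
                rw [← h1] at hn
                exact add_right_cancel hn)
              exact ⟨s', _, ⟨h0, rfl⟩, h'⟩
            · exact absurd (add_eq_left.1 hd') (single_ne _)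
        · exfalso
          have hd : d = b := by
            refine obsI_ok N (i := i) (fun j => decide ((n + Pi.single r 1 : Fin N → ℕ) j ≠ 0))
              (fun r h => hi ⟨r, h⟩) ?_
            intro h
            rw [h] at ho
            simp at ho
          subst hd
          rcases ih with ⟨h, _⟩ | ⟨r', hi', _⟩
          · exact single_ne _ (add_eq_left.1 h)
          · exact hi ⟨r', hi'⟩

theorem convAll : ∀ (k : ℕ) (n : Fin N → ℕ) (d : BV N), ∑ r, n r = k →
    AccS M N (none, d, n) [] := by
  intro k
  induction k with
  | zero =>
    intro n d h
    have : n = 0 := by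
      funext r
      simpa using (Finset.sum_eq_zero_iff.1 h) r (Finset.mem_univ r)
    subst this
    exact .fin d
  | succ k ih =>
    intro n d h
    obtain ⟨r, hr⟩ : ∃ r, n r ≠ 0 := by
      by_contra! h0
      simp [h0] at h
    have e : update n r (n r - 1) + Pi.single r 1 = n := by
      funext i
      by_cases hi : i = r
      · subst hi
        simp
        omega
      · simp [hi]
    have h1 := AccS.step (M := M) _ _ [] [] (TS.conv none d (update n r (n r - 1)) r)
      (by simp [fz, obs]) (ih _ _ (by
        have h2 : ∑ i, (update n r (n r - 1) + Pi.single r 1 : Fin N → ℕ) i = k + 1 := by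
          rw [e]; exact h
        simp only [Pi.add_apply, Finset.sum_add_distrib, Finset.sum_pi_single',
          Finset.mem_univ, if_true] at h2
        omega))
    rw [e] at h1
    exact h1

theorem complete (hN : ∀ e ∈ M.E, e.2.1.reg < N) {c c' : M.Q × Cfg Sig}
    (h : ReflTransGen M.Step c c') (hc' : c'.1 = M.ha) :
    ∃ x, c'.2.2 = c.2.2 ++ x ∧
      ∀ b, AccS M N (some (.inl c.1, b), b, fun i : Fin N => c.2.1 i) x := by
  induction h using ReflTransGen.head_induction_on with
  | refl =>
    refine ⟨[], by simp, fun b => ?_⟩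
    rw [hc']
    exact AccS.step _ _ [] [] (TS.halt _ _ _) (by simp [fz, obs]) (convAll _ _ _ rfl)
  | @head c d h1 _ ih =>
    obtain ⟨x, hx, hacc⟩ := ih
    obtain ⟨q, s, l⟩ := c
    obtain ⟨q', s', l'⟩ := d
    obtain ⟨i, he, hact⟩ := h1
    have hr := hN _ he
    simp only at he hx hacc hact hr ⊢
    cases i with
    | nop =>
      obtain ⟨rfl, rfl⟩ := Prod.mk.inj hact
      refine ⟨x, hx, fun b => ?_⟩
      refine AccS.step _ _ [] x (TS.sel ⟨_, he⟩ _ _ _) (by simp [fz, obs]) ?_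
      refine AccS.step _ _ [] x (TS.ex ⟨_, he⟩ _ _ _) (by simp [fz, obs, obsI]) ?_
      simpa [nbI, icI, icV] using hacc b
    | inc r =>
      obtain ⟨rfl, rfl⟩ := Prod.mk.inj hact
      refine ⟨x, hx, fun b => ?_⟩
      refine AccS.step _ _ [] x (TS.sel ⟨_, he⟩ _ _ _) (by simp [fz, obs]) ?_
      refine AccS.step _ _ [] x (TS.ex ⟨_, he⟩ _ _ _) (by simp [fz, obs, obsI]) ?_
      simp only [nbI, icI, icV, Option.elim]
      rw [upd_add N (r := r) hr]
      exact hacc b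
    | dec r =>
      obtain ⟨h0, hact⟩ := hact
      obtain ⟨rfl, rfl⟩ := Prod.mk.inj hact
      refine ⟨x, hx, fun b => ?_⟩
      have h1 := upd_add N (r := r) hr (update s r (s r - 1))
      have h2 : update (update s r (s r - 1)) r (update s r (s r - 1) r + 1) = s := by
        have : s r - 1 + 1 = s r := by
          have : s r ≠ 0 := h0
          omega
        simp [this]
      rw [h2] at h1
      rw [← h1]
      refine AccS.step _ _ [] x (TS.sel ⟨_, he⟩ _ _ _) (by simp [fz, obs]) ?_
      refine AccS.step _ _ [] x (TS.conv _ _ _ (fr N r)) (by simp [fz, obs, obsI]) ?_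
      refine AccS.step _ _ [] x (TS.ex ⟨_, he⟩ _ _ _) (by simp [fz, obs, obsI]) ?_
      simpa [nbI, icI, icV] using hacc (b + Pi.single (fr N r) 1)
    | zero r =>
      obtain ⟨h0, hact⟩ := hact
      obtain ⟨rfl, rfl⟩ := Prod.mk.inj hact
      refine ⟨x, hx, fun b => ?_⟩
      have h0' : s' (fr N r) = 0 := by rw [fr_val N (r := r) hr]; exact h0
      refine AccS.step _ _ [] x (TS.sel ⟨_, he⟩ _ _ _) (by simp [fz, obs]) ?_
      refine AccS.step _ _ [] x (TS.ex ⟨_, he⟩ _ _ _) (by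
        simp only [fz, obs, obsI, h0']; simp) ?_
      simpa [nbI, icI, icV] using hacc b
    | out a =>
      obtain ⟨rfl, rfl⟩ := Prod.mk.inj hact
      refine ⟨a :: x, by simpa using hx, fun b => ?_⟩
      refine AccS.step _ _ [] (a :: x) (TS.sel ⟨_, he⟩ _ _ _) (by simp [fz, obs]) ?_
      refine AccS.step _ _ [a] x (TS.ex ⟨_, he⟩ _ _ _) (by simp [fz, obs, obsI]) ?_
      simpa [nbI, icI, icV] using hacc b

theorem accS_iff (hN : ∀ e ∈ M.E, e.2.1.reg < N) (x : List Sig) :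
    AccS M N (some (.inl M.st, 0), 0, 0) x ↔
      ∃ s', ReflTransGen M.Step (M.st, (fun _ => 0, [])) (M.ha, (s', x)) := by
  constructor
  · intro h
    simpa using (sound hN h).2 (fun _ => 0) [] rfl
  · rintro ⟨s', h⟩
    obtain ⟨y, hy, h⟩ := complete hN h rfl
    simp only [List.nil_append] at hy
    subst hy
    exact h 0

variable (M N)

def sc : Sym M N → Option (Ctl M N)
  | .nonterminal (.inl c) => some c
  | _ => none

def sd : Sym M N → BV N
  | .terminal r => Pi.single r 1
  | _ => 0

def sn : Sym M N → (Fin N → ℕ)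
  | .nonterminal (.inr r) => Pi.single r 1
  | _ => 0

def ctls (w : List (Sym M N)) : List (Ctl M N) := w.filterMap (sc M N)
def dv (w : List (Sym M N)) : BV N := (w.map (sd M N)).sum
def cn (w : List (Sym M N)) : Fin N → ℕ := (w.map (sn M N)).sum

theorem ctls_app (u v : List (Sym M N)) : ctls M N (u ++ v) = ctls M N u ++ ctls M N v := by
  simp [ctls]
theorem ctls_c (c : Ctl M N) : ctls M N [.nonterminal (.inl c)] = [c] := rfl
theorem ctls_n (r : Fin N) : ctls M N [.nonterminal (.inr r)] = [] := rfl
theorem ctls_t (r : Fin N) : ctls M N [.terminal r] = [] := rfl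
theorem dv_app (u v : List (Sym M N)) : dv M N (u ++ v) = dv M N u + dv M N v := by
  simp [dv]
theorem cn_app (u v : List (Sym M N)) : cn M N (u ++ v) = cn M N u + cn M N v := by
  simp [cn]

def body (e : M.E) (b : BV N) : List (Sym M N) :=
  .nonterminal (.inl (.inl e.1.2.2, nbI N b e.1.2.1)) ::
    ((icI N e.1.2.1).map (fun r => Symbol.nonterminal (.inr r))).toList

inductive Rule : ContextFreeRule (Fin N) (NTm M N) → Prop
  | sel (e : M.E) (b : BV N) :
      Rule ⟨.inl (.inl e.1.1, b), [.nonterminal (.inl (.inr e, b))]⟩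
  | ex (e : M.E) (b : BV N) : Rule ⟨.inl (.inr e, b), body M N e b⟩
  | halt (b : BV N) : Rule ⟨.inl (.inl M.ha, b), []⟩
  | conv (r : Fin N) : Rule ⟨.inr r, [.terminal r]⟩

theorem rule_fin : {r | Rule M N r}.Finite := by
  have := M.fin
  have := M.efin.to_subtype
  have h1 := Set.finite_range (fun p : M.E × BV N =>
    (⟨.inl (.inl p.1.1.1, p.2), [.nonterminal (.inl (.inr p.1, p.2))]⟩ :
      ContextFreeRule (Fin N) (NTm M N)))
  have h2 := Set.finite_range (fun p : M.E × BV N =>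
    (⟨.inl (.inr p.1, p.2), body M N p.1 p.2⟩ : ContextFreeRule (Fin N) (NTm M N)))
  have h3 := Set.finite_range (fun b : BV N =>
    (⟨.inl (.inl M.ha, b), []⟩ : ContextFreeRule (Fin N) (NTm M N)))
  have h4 := Set.finite_range (fun r : Fin N =>
    (⟨.inr r, [.terminal r]⟩ : ContextFreeRule (Fin N) (NTm M N)))
  refine (((h1.union h2).union h3).union h4).subset ?_
  intro r hr
  cases hr with
  | sel e b => exact .inl (.inl (.inl ⟨(e, b), rfl⟩))
  | ex e b => exact .inl (.inl (.inr ⟨(e, b), rfl⟩))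
  | halt b => exact .inl (.inr ⟨b, rfl⟩)
  | conv r => exact .inr ⟨r, rfl⟩

noncomputable def gram : ContextFreeGrammar (Fin N) where
  NT := NTm M N
  initial := .inl (.inl M.st, 0)
  rules := (rule_fin M N).toFinset

def Abs (w : List (Sym M N)) (σ : AS M N) : Prop :=
  ctls M N w = σ.1.toList ∧ dv M N w = σ.2.1 ∧ cn M N w = σ.2.2

theorem produces_iff (w w' : List (Sym M N)) : (gram M N).Produces w w' ↔
    ∃ r, Rule M N r ∧ ∃ p q, w = p ++ [.nonterminal r.input] ++ q ∧ w' = p ++ r.output ++ q := by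
  have h : ∀ r, r ∈ (gram M N).rules ↔ Rule M N r := fun r =>
    (rule_fin M N).mem_toFinset
  constructor
  · rintro ⟨r, hr, hw⟩
    exact ⟨r, (h r).1 hr, ContextFreeRule.rewrites_iff.1 hw⟩
  · rintro ⟨r, hr, hw⟩
    exact ⟨r, (h r).2 hr, ContextFreeRule.rewrites_iff.2 hw⟩

theorem cn_body (e : M.E) (b : BV N) : cn M N (body M N e b) = icV N (icI N e.1.2.1) := by
  cases h : icI N e.1.2.1 <;> simp [cn, body, h, sn, icV]

theorem dv_body (e : M.E) (b : BV N) : dv M N (body M N e b) = 0 := by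
  cases h : icI N e.1.2.1 <;> simp [dv, body, h, sd]

theorem ctls_body (e : M.E) (b : BV N) : ctls M N (body M N e b) =
    [(.inl e.1.2.2, nbI N b e.1.2.1)] := by
  cases h : icI N e.1.2.1 <;> simp [ctls, body, h, sc]

variable {M N}

theorem sandwich {α : Type*} {p q : List α} {a : α} {o : Option α}
    (h : p ++ [a] ++ q = o.toList) : p = [] ∧ q = [] ∧ o = some a := by
  cases o with
  | none => simp at h
  | some b =>
    have hl := congrArg List.length h
    simp at hl
    have hp : p = [] := List.length_eq_zero_iff.1 (by omega)
    have hq : q = [] := List.length_eq_zero_iff.1 (by omega)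
    subst hp hq
    simpa [eq_comm] using h

theorem abs_fwd {w w' : List (Sym M N)} {σ : AS M N} (ha : Abs M N w σ)
    (hp : (gram M N).Produces w w') : ∃ σ', TS M N σ σ' ∧ Abs M N w' σ' := by
  obtain ⟨r, hr, p, q, rfl, rfl⟩ := (produces_iff M N w w').1 hp
  obtain ⟨κ, d, n⟩ := σ
  obtain ⟨h1, h2, h3⟩ := ha
  simp only at h1 h2 h3
  subst h2 h3
  cases hr with
  | sel e b =>
    rw [ctls_app, ctls_app] at h1
    obtain ⟨hp, hq, rfl⟩ := sandwich (a := (Sum.inl e.1.1, b)) h1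
    refine ⟨_, TS.sel e b _ _, ?_, ?_, ?_⟩
    · simp only [ctls_app, hp, hq, ctls_c]
      rfl
    · simp [dv_app, dv, sd]
    · simp [cn_app, cn, sn]
  | ex e b =>
    rw [ctls_app, ctls_app] at h1
    obtain ⟨hp, hq, rfl⟩ := sandwich (a := (Sum.inr e, b)) h1
    refine ⟨_, TS.ex e b _ _, ?_, ?_, ?_⟩
    · simp [ctls_app, hp, hq, ctls_body]
    · simp [dv_app, dv_body]
      simp [dv, sd]
    · simp only [cn_app, cn_body]
      simp [cn, sn]
      abel
  | halt b =>
    rw [ctls_app, ctls_app] at h1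
    obtain ⟨hp, hq, rfl⟩ := sandwich (a := (Sum.inl M.ha, b)) h1
    refine ⟨_, TS.halt b _ _, ?_, ?_, ?_⟩
    · simp [ctls_app, hp, hq]
    · simp [dv_app, dv, sd]
    · simp [cn_app, cn, sn]
  | conv r =>
    have e : cn M N (p ++ [Symbol.nonterminal (Sum.inr r)] ++ q) =
        cn M N (p ++ q) + Pi.single r 1 := by
      simp [cn, sn]
      abel
    rw [e]
    refine ⟨_, TS.conv _ _ _ r, ?_, ?_, ?_⟩
    · rw [← h1]
      simp only [ctls_app, ctls_n, ctls_t]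
    · simp [dv, sd]
      abel
    · simp [cn, sn]

theorem ctls_split {w : List (Sym M N)} {c : Ctl M N} (h : ctls M N w = [c]) :
    ∃ p q, w = p ++ [.nonterminal (.inl c)] ++ q ∧ ctls M N p = [] ∧ ctls M N q = [] := by
  obtain ⟨p, a, q, rfl, hp, ha, hq⟩ : ∃ p a q, w = p ++ a :: q ∧ (∀ x ∈ p, sc M N x = none) ∧
      sc M N a = some c ∧ q.filterMap (sc M N) = [] := by
    simpa using List.filterMap_eq_cons_iff.1 h
  have : a = .nonterminal (.inl c) := by
    rcases a with r | c' | r <;> simp [sc] at ha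
    rw [ha]
  subst this
  exact ⟨p, q, by simp, by simpa [ctls] using hp, hq⟩

theorem cn_split {w : List (Sym M N)} {r : Fin N} (h : cn M N w r ≠ 0) :
    ∃ p q, w = p ++ [.nonterminal (.inr r)] ++ q := by
  induction w with
  | nil => simp [cn] at h
  | cons a w ih =>
    by_cases ha : a = .nonterminal (.inr r)
    · exact ⟨[], w, by simp [ha]⟩
    · have : sn M N a r = 0 := by
        rcases a with r' | c' | r' <;> simp [sn] at ha ⊢
        rw [Pi.single_eq_of_ne (Ne.symm ha)]
      have h' : cn M N w r ≠ 0 := by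
        simpa [cn, this] using h
      obtain ⟨p, q, rfl⟩ := ih h'
      exact ⟨a :: p, q, by simp⟩

theorem abs_bwd {w : List (Sym M N)} {σ σ' : AS M N} (ha : Abs M N w σ)
    (ht : TS M N σ σ') : ∃ w', (gram M N).Produces w w' ∧ Abs M N w' σ' := by
  obtain ⟨h1, h2, h3⟩ := ha
  cases ht with
  | sel e b d n =>
    simp only at h1 h2 h3
    subst h2 h3
    obtain ⟨p, q, rfl, hp, hq⟩ := ctls_split h1
    refine ⟨_, (produces_iff M N _ _).2 ⟨_, Rule.sel e b, p, q, rfl, rfl⟩, ?_, ?_, ?_⟩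
    · simp only [ctls_app, hp, hq, ctls_c]
      rfl
    · simp [dv_app, dv, sd]
    · simp [cn_app, cn, sn]
  | ex e b d n =>
    simp only at h1 h2 h3
    subst h2 h3
    obtain ⟨p, q, rfl, hp, hq⟩ := ctls_split h1
    refine ⟨_, (produces_iff M N _ _).2 ⟨_, Rule.ex e b, p, q, rfl, rfl⟩, ?_, ?_, ?_⟩
    · simp [ctls_app, hp, hq, ctls_body]
    · simp [dv_app, dv_body]
      simp [dv, sd]
    · simp only [cn_app, cn_body]
      simp [cn, sn]
      abel
  | halt b d n =>
    simp only at h1 h2 h3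
    subst h2 h3
    obtain ⟨p, q, rfl, hp, hq⟩ := ctls_split h1
    refine ⟨_, (produces_iff M N _ _).2 ⟨_, Rule.halt b, p, q, rfl, rfl⟩, ?_, ?_, ?_⟩
    · simp [ctls_app, hp, hq]
    · simp [dv_app, dv, sd]
    · simp [cn_app, cn, sn]
  | conv κ d n r =>
    simp only at h1 h2 h3
    subst h2
    obtain ⟨p, q, rfl⟩ := cn_split (w := w) (r := r) (by rw [h3]; simp)
    refine ⟨_, (produces_iff M N _ _).2 ⟨_, Rule.conv r, p, q, rfl, rfl⟩, ?_, ?_, ?_⟩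
    · simp only [← h1]
      simp only [ctls_app, ctls_n, ctls_t]
    · simp [dv, sd]
      abel
    · have e : cn M N (p ++ [Symbol.nonterminal (Sum.inr r)] ++ q) =
          cn M N (p ++ [Symbol.terminal r] ++ q) + Pi.single r 1 := by
        simp [cn, sn]
        abel
      rw [e] at h3
      exact add_right_cancel h3

theorem abs_term {w : List (Sym M N)} {d : BV N} (h : Abs M N w (none, d, 0)) :
    ∃ t : List (Fin N), w = t.map Symbol.terminal := by
  obtain ⟨h1, h2, h3⟩ := h
  simp only at h1 h3
  clear h2
  induction w with
  | nil => exact ⟨[], rfl⟩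
  | cons a w ih =>
    simp only [Option.toList] at h1
    rcases a with r | c | r
    · obtain ⟨t, rfl⟩ := ih (by simpa [ctls, sc] using h1) (by simpa [cn, sn] using h3)
      exact ⟨r :: t, rfl⟩
    · simp [ctls, sc] at h1
    · have := congrFun h3 r
      simp [cn, sn] at this

theorem term_abs (t : List (Fin N)) :
    ∃ d, Abs M N (t.map Symbol.terminal) (none, d, 0) := by
  refine ⟨_, ?_, rfl, ?_⟩
  · induction t with
    | nil => rfl
    | cons a t ih => simpa [ctls, sc] using ih
  · induction t with
    | nil => rfl
    | cons a t ih => simpa [cn, sn] using ih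

theorem abs_term_inv {t : List (Fin N)} {σ : AS M N}
    (h : Abs M N (t.map Symbol.terminal) σ) : ∃ d, σ = (none, d, 0) := by
  obtain ⟨d, h1, h2, h3⟩ := term_abs (M := M) t
  obtain ⟨κ, d', n⟩ := σ
  obtain ⟨h1', h2', h3'⟩ := h
  refine ⟨d', ?_⟩
  have e1 : κ = none := by
    rw [h1] at h1'
    simpa using h1'.symm
  have e3 : n = 0 := by
    rw [h3] at h3'
    exact h3'.symm
  rw [e1, e3]

variable (M N) in
def phi (w : List (Sym M N)) : Option (Ctl M N) × BV N × (Fin N → Bool) :=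
  ((ctls M N w).head?, dv M N w, fun r => decide (cn M N w r ≠ 0))

variable (M N) in
def AA (w : List (Symbol (Fin N) (gram M N).NT)) : Option (Option Sig) := obs M N (phi M N w)

theorem abs_phi {w : List (Sym M N)} {σ : AS M N} (h : Abs M N w σ) :
    phi M N w = fz M N σ := by
  obtain ⟨h1, h2, h3⟩ := h
  simp only [phi, fz, h1, h2, h3]
  simp

variable (M N) in
inductive Acc : List (Symbol (Fin N) (gram M N).NT) → List Sig → Prop
  | fin (t : List (Fin N)) : Acc (t.map Symbol.terminal) []
  | step (w w' : List (Symbol (Fin N) (gram M N).NT)) (y x : List Sig) :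
      (gram M N).Produces w w' → (AA M N w).toList = y.map some → Acc w' x → Acc w (y ++ x)

theorem acc_iff {w : List (Sym M N)} {σ : AS M N} (h : Abs M N w σ) (x : List Sig) :
    Acc M N w x ↔ AccS M N σ x := by
  constructor
  · intro ha
    induction ha generalizing σ with
    | fin t =>
      obtain ⟨d, rfl⟩ := abs_term_inv h
      exact .fin d
    | step w w' y x hp ho _ ih =>
      obtain ⟨σ', ht, h'⟩ := abs_fwd h hp
      exact .step _ _ _ _ ht (by rw [← abs_phi h]; exact ho) (ih h')
  · intro ha
    induction ha generalizing w with
    | fin d =>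
      obtain ⟨t, rfl⟩ := abs_term h
      exact .fin t
    | step σ σ' y x ht ho _ ih =>
      obtain ⟨w', hp, h'⟩ := abs_bwd h ht
      exact .step _ _ _ _ hp (by rw [← abs_phi h] at ho; exact ho) (ih h')

theorem AA_term (t : List (Fin N)) : AA M N (t.map Symbol.terminal) = none := by
  obtain ⟨d, h⟩ := term_abs (M := M) t
  have := abs_phi h
  exact (congrArg (obs M N) this).trans rfl

theorem acc_of_chain (ws : List (List (Symbol (Fin N) (gram M N).NT))) :
    ∀ w (x : List Sig), ws.head? = some w → ws.IsChain (gram M N).Produces →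
      (∃ t : List (Fin N), ws.getLast? = some (t.map Symbol.terminal)) →
      x.map some = (ws.map fun w => (AA M N w).toList).flatten → Acc M N w x := by
  induction ws with
  | nil => simp
  | cons v ws ih =>
    intro w x h1 h2 h3 h4
    obtain rfl : v = w := by simpa using h1
    cases ws with
    | nil =>
      obtain ⟨t, ht⟩ := h3
      obtain rfl : v = t.map Symbol.terminal := by simpa using ht
      have : x = [] := by simpa [AA_term] using h4
      subst this
      exact .fin t
    | cons v' ws =>
      rw [List.map_cons, List.flatten_cons, List.map_eq_append_iff] at h4
      obtain ⟨y, z, rfl, hy, hz⟩ := h4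
      rw [List.isChain_cons_cons] at h2
      refine .step v v' y z h2.1 hy.symm (ih v' z rfl h2.2 ?_ hz)
      simpa using h3

theorem chain_of_acc {w : List (Symbol (Fin N) (gram M N).NT)} {x : List Sig}
    (h : Acc M N w x) : ∃ ws : List (List (Symbol (Fin N) (gram M N).NT)),
      ws.head? = some w ∧ ws.IsChain (gram M N).Produces ∧
      (∃ t : List (Fin N), ws.getLast? = some (t.map Symbol.terminal)) ∧
      x.map some = (ws.map fun w => (AA M N w).toList).flatten := by
  induction h with
  | fin t => exact ⟨[t.map Symbol.terminal], rfl, by simp, ⟨t, rfl⟩, by simp [AA_term]⟩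
  | step w w' y x hp ho _ ih =>
    obtain ⟨ws, h1, h2, ⟨t, h3⟩, h4⟩ := ih
    obtain ⟨ws, rfl⟩ : ∃ ws', ws = w' :: ws' := by
      cases ws with
      | nil => simp at h1
      | cons a ws => exact ⟨ws, by simpa using h1⟩
    refine ⟨w :: w' :: ws, rfl, List.isChain_cons_cons.2 ⟨hp, h2⟩, ⟨t, by simpa using h3⟩, ?_⟩
    rw [List.map_cons, List.flatten_cons, List.map_append, ← h4, ho]

theorem lang_eq (hN : ∀ e ∈ M.E, e.2.1.reg < N) (x : List Sig) :
    x ∈ goLangBot (gram M N) (AA M N) ↔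
      ∃ s', ReflTransGen M.Step (M.st, (fun _ => 0, [])) (M.ha, (s', x)) := by
  have h0 : Abs M N [.nonterminal (.inl (.inl M.st, 0))] (some (.inl M.st, 0), 0, 0) := by
    refine ⟨rfl, ?_, ?_⟩
    · simp [dv, sd]
    · simp [cn, sn]
  rw [← accS_iff hN, ← acc_iff h0]
  constructor
  · rintro ⟨ws, h1, h2, h3, h4⟩
    exact acc_of_chain ws _ x h1 h2 h3 h4
  · intro h
    obtain ⟨ws, h1, h2, h3, h4⟩ := chain_of_acc h
    exact ⟨ws, h1, h2, h3, h4⟩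

theorem phi_step (w : List (Sym M N)) (a : Sym M N) : phi M N (w ++ [a]) =
    ((phi M N w).1.or (sc M N a), (phi M N w).2.1 + sd M N a,
      fun r => (phi M N w).2.2 r || decide (sn M N a r ≠ 0)) := by
  refine Prod.ext ?_ (Prod.ext ?_ ?_)
  · simp only [phi, ctls_app, List.head?_append]
    congr 1
    cases h : sc M N a <;> simp [ctls, h]
  · simp [phi, dv]
  · funext r
    simp only [phi, cn_app]
    have h : cn M N [a] = sn M N a := by simp [cn]
    rw [h, Pi.add_apply]
    by_cases h1 : cn M N w r = 0 <;> by_cases h2 : sn M N a r = 0 <;> simp [h1, h2]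

variable (M N) in
def dfa (o : Option (Option Sig)) :
    DFA (Sym M N) (Option (Ctl M N) × BV N × (Fin N → Bool)) where
  step s a := (s.1.or (sc M N a), s.2.1 + sd M N a,
    fun r => s.2.2 r || decide (sn M N a r ≠ 0))
  start := phi M N []
  accept := {s | obs M N s = o}

theorem regular : ObserverRegular (AA M N) := by
  have := M.fin
  have := M.efin.to_subtype
  intro o
  refine ⟨Option (Ctl M N) × BV N × (Fin N → Bool), Fintype.ofFinite _, dfa M N o, ?_⟩
  have key : ∀ w, (dfa M N o).eval w = phi M N w := by
    intro w
    induction w using List.reverseRecOn with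
    | nil => rfl
    | append_singleton w a ih =>
      rw [DFA.eval_append_singleton, ih, phi_step]
      rfl
  ext w
  refine (DFA.mem_accepts (M := dfa M N o) (x := w)).trans ?_
  rw [key w]
  rfl

end Sim

theorem exists_bound (M : Mach Sig) : ∃ K : ℕ, ∀ e ∈ M.E, e.2.1.reg < K + 1 := by
  obtain ⟨K, hK⟩ := (M.efin.image fun e => e.2.1.reg).bddAbove
  exact ⟨K, fun e he => Nat.lt_succ_of_le (hK ⟨e, he, rfl⟩)⟩

end GO

/-- For every recursively enumerable language `L` over an alphabet `Σ` there is
a G/O system `Ω = (G, A)` with `G` a context-free grammar (over some finite alphabets of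
terminals and nonterminals) and `A` a monadic transducer with output alphabet `Σ ∪ {⊥}`
such that `L_{⊥,f}(Ω) = L`. -/
theorem go_systems_computationally_complete
    {Sig : Type} [Fintype Sig] [Primcodable Sig] (L : Language Sig)
    (hL : REPred fun x => x ∈ L) :
    ∃ (T : Type) (_ : Finite T) (G : ContextFreeGrammar T) (_ : Finite G.NT)
      (A : List (Symbol T G.NT) → Option (Option Sig)),
      ObserverRegular A ∧ goLangBot G A = L := by
  obtain ⟨R, ⟨M, hM⟩, hR⟩ := GO.lang_rz L hL
  obtain ⟨K, hK⟩ := GO.exists_bound M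
  have := M.fin
  have := M.efin.to_subtype
  refine ⟨Fin (K + 1), inferInstance, GO.gram M (K + 1), ?_, GO.AA M (K + 1), GO.regular, ?_⟩
  · show Finite (GO.NTm M (K + 1))
    infer_instance
  · ext x
    rw [GO.lang_eq hK, hR]
    simp only [hM]
end

section
/- Let Ω = (G, A) be a grammar/observer system in which G is a nonterminal-bounded context-free grammar, i.e., there exists a constant k such that every sentential form derivable from the start symbol S of G contains at most k occurrences of nonterminal symbols. Then the language L_{⊥,f}(Ω) is regular. -/
namespace GOProof

section Generic
variable {S Γ : Type}

inductive Acc (step : S → S → Prop) (out : S → Option Γ) (fin : S → Prop) : S → List Γ → Prop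
  | nil {s} : fin s → Acc step out fin s []
  | step {s t y} : step s t → Acc step out fin t y → Acc step out fin s ((out t).toList ++ y)

inductive Reach (step : S → S → Prop) (out : S → Option Γ) (s0 : S) : List Γ → S → Prop
  | init : Reach step out s0 (out s0).toList s0
  | step {s t x} : Reach step out s0 x s → step s t → Reach step out s0 (x ++ (out t).toList) t

variable {step : S → S → Prop} {out : S → Option Γ} {fin : S → Prop} {s0 : S}

theorem reach_acc {x s} (h : Reach step out s0 x s) : ∀ y, Acc step out fin s y →
    ∃ z, Acc step out fin s0 z ∧ x ++ y = (out s0).toList ++ z := by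
  induction h with
  | init => intro y hy; exact ⟨y, hy, rfl⟩
  | step hr hs ih =>
    intro y hy
    obtain ⟨z, hz, e⟩ := ih _ (Acc.step hs hy)
    exact ⟨z, hz, by rw [← e]; simp⟩

theorem reach_derives {x s} (h : Reach step out s0 x s) : Relation.ReflTransGen step s0 s := by
  induction h with
  | init => exact .refl
  | step hr hs ih => exact ih.tail hs

theorem toList_len (o : Option Γ) : o.toList.length ≤ 1 := by cases o <;> simp

theorem acc_split {s y} (h : Acc step out fin s y) : ∀ x u v, Reach step out s0 x s →
    x ++ y = u ++ v → x.length ≤ u.length →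
    ∃ s', Reach step out s0 u s' ∧ Acc step out fin s' v := by
  induction h with
  | @nil s hf =>
    intro x u v hr e hl
    have h1 := congrArg List.length e
    simp only [List.length_append, List.length_nil] at h1
    have hv : v = [] := List.eq_nil_of_length_eq_zero (by omega)
    subst hv
    simp only [List.append_nil] at e
    subst e
    exact ⟨s, hr, .nil hf⟩
  | @step s t y hs hy ih =>
    intro x u v hr e hl
    rcases Nat.eq_or_lt_of_le hl with h | h
    · obtain ⟨rfl, rfl⟩ := List.append_inj e h
      exact ⟨s, hr, .step hs hy⟩
    · refine ih (x ++ (out t).toList) u v (hr.step hs) (by rw [← e]; simp) ?_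
      have := toList_len (out t)
      simp only [List.length_append]
      omega

theorem acc_congr {Q : Type} (φ : S → Q)
    (hstep : ∀ s s' t, φ s = φ s' → step s t → ∃ t', step s' t' ∧ φ t = φ t')
    (hout : ∀ s s', φ s = φ s' → out s = out s')
    (hfin : ∀ s s', φ s = φ s' → fin s → fin s') {s y} (h : Acc step out fin s y) :
    ∀ s', φ s = φ s' → Acc step out fin s' y := by
  induction h with
  | nil hf => intro s' e; exact .nil (hfin _ _ e hf)
  | step hs hy ih =>
    intro s' e
    obtain ⟨t', ht, e'⟩ := hstep _ _ _ e hs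
    rw [hout _ _ e']
    exact .step ht (ih _ e')

theorem regular_generic {Q : Type} (φ : S → Q)
    (hstep : ∀ s s' t, φ s = φ s' → step s t → ∃ t', step s' t' ∧ φ t = φ t')
    (hout : ∀ s s', φ s = φ s' → out s = out s')
    (hfin : ∀ s s', φ s = φ s' → fin s → fin s')
    (hQ : Set.Finite (φ '' {s | Relation.ReflTransGen step s0 s})) (L : Language Γ)
    (hL : ∀ x, x ∈ L ↔ ∃ z, Acc step out fin s0 z ∧ x = (out s0).toList ++ z) :
    L.IsRegular := by
  apply Language.IsRegular.of_finite_range_leftQuotient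
  let C : Q → Set (List Γ) := fun q => {y | ∃ s, φ s = q ∧ Acc step out fin s y}
  have hF := ((hQ.image C).powerset.image (fun F => Set.sUnion F)).insert (L : Set (List Γ))
  refine hF.subset ?_
  rintro _ ⟨u, rfl⟩
  by_cases hu : u = []
  · subst hu; exact Or.inl rfl
  right
  refine ⟨C '' (φ '' {s | Reach step out s0 u s}), ?_, ?_⟩
  · apply Set.image_mono
    apply Set.image_mono
    intro s hs
    exact reach_derives hs
  · ext v
    constructor
    · rintro ⟨_, ⟨_, ⟨s, hs, rfl⟩, rfl⟩, ⟨s', e, ha⟩⟩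
      have ha' := acc_congr φ hstep hout hfin ha s e
      obtain ⟨z, hz, e⟩ := reach_acc hs v ha'
      exact (hL (u ++ v)).2 ⟨z, hz, e⟩
    · intro hv
      obtain ⟨z, hz, e⟩ := (hL (u ++ v)).1 hv
      obtain ⟨s', h1, h2⟩ := acc_split hz _ u v Reach.init e.symm (by
        have := toList_len (out s0)
        have := List.length_pos_iff.2 hu
        omega)
      exact ⟨_, ⟨_, ⟨s', h1, rfl⟩, rfl⟩, ⟨s', rfl, h2⟩⟩

theorem acc_iff_chain (s : S) (y : List Γ) : Acc step out fin s y ↔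
    ∃ ws : List S, List.IsChain step (s :: ws) ∧ (∃ t, (s :: ws).getLast? = some t ∧ fin t) ∧
      y = (ws.map fun w => (out w).toList).flatten := by
  constructor
  · intro h
    induction h with
    | @nil s hf => exact ⟨[], by simp, ⟨s, by simp, hf⟩, by simp⟩
    | @step s t y hs hy ih =>
      obtain ⟨ws, h1, ⟨t', h2, h3⟩, rfl⟩ := ih
      exact ⟨t :: ws, List.isChain_cons_cons.2 ⟨hs, h1⟩, ⟨t', by simpa using h2, h3⟩, by simp⟩
  · rintro ⟨ws, h1, ⟨t, h2, h3⟩, rfl⟩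
    induction ws generalizing s with
    | nil =>
      simp at h2
      subst h2
      exact .nil h3
    | cons a ws ih =>
      rw [List.isChain_cons_cons] at h1
      simp only [List.map_cons, List.flatten_cons]
      exact .step h1.1 (ih a h1.2 (by simpa using h2))

end Generic

section Abs
variable {T N Q : Type} (δ : Q → Symbol T N → Q)

def phi : List (Symbol T N) → (Q → Q) × List (N × (Q → Q))
  | [] => (id, [])
  | .terminal t :: w => (fun q => (phi w).1 (δ q (.terminal t)), (phi w).2)
  | .nonterminal X :: w => (id, (X, (phi w).1) :: (phi w).2)

def ev : (Q → Q) → List (N × (Q → Q)) → Q → Q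
  | m, [], q => m q
  | m, (X, m') :: l, q => ev m' l (δ (m q) (.nonterminal X))

theorem ev_pre (f : Q → Q) (m) (l : List (N × (Q → Q))) (q : Q) :
    ev δ (fun q => m (f q)) l q = ev δ m l (f q) := by
  rcases l with _ | ⟨⟨X, m'⟩, l⟩ <;> rfl

theorem foldl_eq (w : List (Symbol T N)) (q : Q) :
    w.foldl δ q = ev δ (phi δ w).1 (phi δ w).2 q := by
  induction w generalizing q with
  | nil => rfl
  | cons a w ih =>
    rcases a with t | X
    · simp only [List.foldl_cons, phi, ih]
      exact (ev_pre δ (fun q => δ q (.terminal t)) _ _ _).symm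
    · simp only [List.foldl_cons, phi, ih]
      rfl

def mul : (Q → Q) → List (N × (Q → Q)) → (Q → Q) × List (N × (Q → Q)) →
    (Q → Q) × List (N × (Q → Q))
  | m, [], b => (fun q => b.1 (m q), b.2)
  | m, (X, m') :: l, b => (m, (X, (mul m' l b).1) :: (mul m' l b).2)

theorem mul_pre (f : Q → Q) (m) (l : List (N × (Q → Q))) (b) :
    mul (fun q => m (f q)) l b = (fun q => (mul m l b).1 (f q), (mul m l b).2) := by
  rcases l with _ | ⟨⟨X, m'⟩, l⟩ <;> rfl

theorem phi_append (u v : List (Symbol T N)) :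
    phi δ (u ++ v) = mul (phi δ u).1 (phi δ u).2 (phi δ v) := by
  induction u with
  | nil => rfl
  | cons a u ih =>
    rcases a with t | X
    · simp only [List.cons_append, phi, ih]
      exact (mul_pre (fun q => δ q (.terminal t)) _ _ _).symm
    · simp only [List.cons_append, phi, ih]
      rfl

theorem split0 (X : N) (n : Q → Q) (k : List (N × (Q → Q))) (w : List (Symbol T N)) :
    ∀ m, phi δ w = (m, (X, n) :: k) →
    ∃ p q, w = p ++ .nonterminal X :: q ∧ phi δ p = (m, []) ∧ phi δ q = (n, k) := by
  induction w with
  | nil => intro m h; simp [phi] at h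
  | cons a w ih =>
    intro m h
    rcases a with t | Y
    · simp only [phi, Prod.mk.injEq] at h
      obtain ⟨p, q, rfl, hp, hq⟩ := ih (phi δ w).1 (Prod.ext rfl h.2)
      refine ⟨.terminal t :: p, q, rfl, ?_, hq⟩
      simp only [phi, hp, Prod.mk.injEq, and_true]
      exact h.1
    · simp only [phi, Prod.mk.injEq, List.cons.injEq] at h
      obtain ⟨rfl, ⟨rfl, h1⟩, h2⟩ := h
      exact ⟨[], w, rfl, rfl, Prod.ext h1 h2⟩

theorem split1 (X : N) (n : Q → Q) (k : List (N × (Q → Q))) (l : List (N × (Q → Q))) :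
    ∀ m w, phi δ w = mul m l (id, (X, n) :: k) →
    ∃ p q : List (Symbol T N), w = p ++ .nonterminal X :: q ∧ phi δ p = (m, l) ∧
      phi δ q = (n, k) := by
  induction l with
  | nil => intro m w h; exact split0 δ X n k w m h
  | cons a l ih =>
    obtain ⟨Y, m1⟩ := a
    intro m w h
    obtain ⟨p, w', rfl, hp, hq⟩ := split0 δ _ _ _ w m h
    obtain ⟨p', q, rfl, hp', hq'⟩ := ih m1 w' hq
    refine ⟨p ++ .nonterminal Y :: p', q, by simp, ?_, hq'⟩
    rw [phi_append, hp]
    simp only [phi, hp']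
    rfl

theorem split2 (X : N) (p q w : List (Symbol T N))
    (h : phi δ (p ++ .nonterminal X :: q) = phi δ w) :
    ∃ p' q', w = p' ++ .nonterminal X :: q' ∧ phi δ p' = phi δ p ∧ phi δ q' = phi δ q := by
  rw [phi_append] at h
  exact split1 δ X _ _ _ _ w h.symm

theorem phi_final (w : List (Symbol T N)) :
    (phi δ w).2 = [] ↔ ∃ t : List T, w = t.map Symbol.terminal := by
  induction w with
  | nil => exact ⟨fun _ => ⟨[], rfl⟩, fun _ => rfl⟩
  | cons a w ih =>
    rcases a with t | X
    · simp only [phi, ih]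
      constructor
      · rintro ⟨l, rfl⟩; exact ⟨t :: l, rfl⟩
      · rintro ⟨l, h⟩
        rcases l with _ | ⟨b, l⟩
        · simp at h
        · simp only [List.map_cons, List.cons.injEq] at h
          exact ⟨l, h.2⟩
    · simp only [phi]
      constructor
      · intro h; simp at h
      · rintro ⟨l, h⟩
        rcases l with _ | ⟨b, l⟩ <;> simp at h

theorem phi_len (w : List (Symbol T N)) : (phi δ w).2.length = nonterminalCount w := by
  induction w with
  | nil => rfl
  | cons a w ih =>
    rcases a with t | X
    · simpa [phi, nonterminalCount] using ih
    · simpa [phi, nonterminalCount] using ih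

end Abs

theorem comap_regular {α β : Type} (f : α → β) {L : Language β} (h : L.IsRegular) :
    Language.IsRegular ({x | x.map f ∈ L} : Language α) := by
  obtain ⟨σ, hσ, M, rfl⟩ := h
  exact ⟨σ, hσ, M.comap f, M.accepts_comap f⟩

theorem goLang_regular {T Sig : Type} [Finite Sig] (G : ContextFreeGrammar T) [Finite G.NT]
    (k : ℕ)
    (hbound : ∀ w : List (Symbol T G.NT),
      G.Derives [Symbol.nonterminal G.initial] w → nonterminalCount w ≤ k)
    (A : List (Symbol T G.NT) → Option (Option Sig)) (hA : ObserverRegular A) :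
    Language.IsRegular (goLang G A) := by
  choose σ hσ M hM using hA
  let δ : (∀ o, σ o) → Symbol T G.NT → ∀ o, σ o := fun q a o => (M o).step (q o) a
  have hfold : ∀ (w : List (Symbol T G.NT)) q o, w.foldl δ q o = (M o).evalFrom (q o) w := by
    intro w
    induction w with
    | nil => intro q o; rfl
    | cons a w ih => intro q o; exact ih _ o
  have hQf : Finite (∀ o, σ o) := by
    have : ∀ o, Finite (σ o) := fun o => @Finite.of_fintype _ (hσ o)
    exact Pi.finite
  refine regular_generic (step := G.Produces) (out := A)
    (fin := fun w => ∃ t : List T, w = t.map Symbol.terminal)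
    (s0 := [Symbol.nonterminal G.initial]) (phi δ) ?_ ?_ ?_ ?_ _ ?_
  · rintro s s' t e ⟨r, hr, hrw⟩
    obtain ⟨p, q, rfl, rfl⟩ := hrw.exists_parts
    obtain ⟨p', q', rfl, hp, hq⟩ := split2 δ r.input p q s' (by rw [← e]; simp)
    refine ⟨p' ++ r.output ++ q', ⟨r, hr, ?_⟩, ?_⟩
    · have := r.rewrites_of_exists_parts p' q'
      simpa using this
    · simp only [phi_append, hp, hq]
  · intro s s' e
    have h1 : ∀ w, A w = A s ↔ w ∈ (M (A s)).accepts := by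
      intro w
      rw [hM]
      rfl
    have h2 := (h1 s).1 rfl
    refine ((h1 s').2 ?_).symm
    rw [DFA.mem_accepts, DFA.eval] at h2 ⊢
    have h3 := congrFun ((foldl_eq δ s (fun o => (M o).start)).trans
      ((congrArg (fun a => ev δ a.1 a.2 (fun o => (M o).start)) e).trans
        (foldl_eq δ s' (fun o => (M o).start)).symm)) (A s)
    rw [hfold, hfold] at h3
    rwa [← h3]
  · intro s s' e h
    rw [← phi_final δ] at h ⊢
    rwa [← e]
  · have h1 : Set.Finite {l : List (G.NT × ((∀ o, σ o) → ∀ o, σ o)) | l.length ≤ k} :=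
      List.finite_length_le _ k
    refine ((Set.finite_univ (α := (∀ o, σ o) → ∀ o, σ o)).prod h1).subset ?_
    rintro _ ⟨w, hw, rfl⟩
    refine ⟨trivial, ?_⟩
    simp only [Set.mem_setOf_eq, phi_len]
    exact hbound w hw
  · intro x
    simp only [acc_iff_chain]
    constructor
    · rintro ⟨ws, h1, h2, ⟨t, h3⟩, rfl⟩
      rcases ws with _ | ⟨a, ws⟩
      · simp at h1
      · simp only [List.head?_cons, Option.some.injEq] at h1
        subst h1
        exact ⟨_, ⟨ws, h2, ⟨_, h3, ⟨t, rfl⟩⟩, rfl⟩, by simp⟩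
    · rintro ⟨_, ⟨ws, h2, ⟨_, h3, ⟨t, rfl⟩⟩, rfl⟩, rfl⟩
      exact ⟨_ :: ws, rfl, h2, ⟨t, h3⟩, by simp⟩

end GOProof


/-- If the context-free grammar `G` of a G/O system `Ω = (G, A)` is
nonterminal bounded (some constant `k` bounds the number of occurrences of nonterminals in
every sentential form derivable from the start symbol), then `L_{⊥,f}(Ω)` is regular. -/
theorem goLangBot_regular_of_nonterminal_bounded
    {T Sig : Type} [Finite T] [Finite Sig] (G : ContextFreeGrammar T) [Finite G.NT]
    (k : ℕ)
    (hbound : ∀ w : List (Symbol T G.NT),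
      G.Derives [Symbol.nonterminal G.initial] w → nonterminalCount w ≤ k)
    (A : List (Symbol T G.NT) → Option (Option Sig)) (hA : ObserverRegular A) :
    Language.IsRegular (goLangBot G A) := by
  exact GOProof.comap_regular some (GOProof.goLang_regular G k hbound A hA)
end

section
/- Every regular (right-linear) grammar is nonterminal bounded (every sentential form derivable from the start symbol contains at most one occurrence of a nonterminal); consequently, for every grammar/observer system Ω = (G, A) in which G is a regular grammar, the language L_{⊥,f}(Ω) is regular. -/
/-- A regular (right-linear) grammar: every production is of the form `N → tN'`, `N → t`
or `N → λ`. -/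
def IsRightLinear {T : Type} (G : ContextFreeGrammar T) : Prop :=
  ∀ r ∈ G.rules, r.output = [] ∨ (∃ t : T, r.output = [Symbol.terminal t]) ∨
    ∃ (t : T) (N' : G.NT), r.output = [Symbol.terminal t, Symbol.nonterminal N']

/-- Sentential form: a terminal word followed by at most one nonterminal. -/
def rlForm {T NT : Type} (t : List T) (M : Option NT) : List (Symbol T NT) :=
  t.map Symbol.terminal ++ M.toList.map Symbol.nonterminal

lemma rlForm_output {T : Type} {G : ContextFreeGrammar T} (hG : IsRightLinear G)
    (r : ContextFreeRule T G.NT) (hr : r ∈ G.rules) :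
    ∃ u M, r.output = rlForm u M := by
  rcases hG r hr with h | ⟨t, h⟩ | ⟨t, N, h⟩
  · exact ⟨[], none, by simp [h, rlForm]⟩
  · exact ⟨[t], none, by simp [h, rlForm]⟩
  · exact ⟨[t], some N, by simp [h, rlForm]⟩

lemma rlForm_rewrites {T NT : Type} {r : ContextFreeRule T NT} (t : List T) :
    ∀ (M : Option NT) (w : List (Symbol T NT)), r.Rewrites (rlForm t M) w →
    M = some r.input ∧ w = t.map Symbol.terminal ++ r.output := by
  induction t with
  | nil =>
    intro M w h
    cases M with
    | none => simp only [rlForm] at h; cases h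
    | some N =>
      simp only [rlForm, List.map_nil, Option.toList_some, List.map_cons, List.nil_append] at h
      cases h with
      | head s => simp
      | cons x h => cases h
  | cons a t ih =>
    intro M w h
    have h' : r.Rewrites (Symbol.terminal a :: rlForm t M) w := h
    cases h' with
    | cons x h₂ =>
      obtain ⟨h1, h2⟩ := ih _ _ h₂
      exact ⟨h1, by simp [h2]⟩

lemma rlForm_produces {T : Type} {G : ContextFreeGrammar T} (hG : IsRightLinear G)
    (t : List T) (M : Option G.NT) (w : List (Symbol T G.NT)) (h : G.Produces (rlForm t M) w) :
    ∃ r ∈ G.rules, ∃ u M', M = some r.input ∧ r.output = rlForm u M' ∧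
      w = rlForm (t ++ u) M' := by
  obtain ⟨r, hr, h⟩ := h
  obtain ⟨h1, h2⟩ := rlForm_rewrites t M w h
  obtain ⟨u, M', h3⟩ := rlForm_output hG r hr
  exact ⟨r, hr, u, M', h1, h3, by simp [h2, h3, rlForm]⟩

lemma rlForm_produces_of {T : Type} {G : ContextFreeGrammar T}
    (t u : List T) (M' : Option G.NT) (r : ContextFreeRule T G.NT) (hr : r ∈ G.rules)
    (h : r.output = rlForm u M') : G.Produces (rlForm t (some r.input)) (rlForm (t ++ u) M') := by
  refine ⟨r, hr, ?_⟩
  have := r.rewrites_of_exists_parts (t.map Symbol.terminal) []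
  simpa [h, rlForm] using this

lemma rlForm_count {T NT : Type} (t : List T) (M : Option NT) :
    nonterminalCount (rlForm t M) ≤ 1 := by
  induction t with
  | nil => cases M <;> simp [nonterminalCount, rlForm]
  | cons a t ih => exact ih

/-- A regular observer is computed by one finite DFA with output-labelled states. -/
lemma observer_dfa {V Γ : Type} [Finite Γ] (A : List V → Option Γ) (hA : ObserverRegular A) :
    ∃ (Q : Type) (_ : Finite Q) (D : DFA V Q) (out : Q → Option Γ), ∀ w, A w = out (D.eval w) := by
  choose σ hσ M hM using hA
  let D : DFA V (∀ o, σ o) := ⟨fun q a o => (M o).step (q o) a, fun o => (M o).start, ∅⟩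
  have hD : ∀ w o, D.eval w o = (M o).eval w := by
    intro w o
    induction w using List.reverseRecOn with
    | nil => rfl
    | append_singleton w a ih => simp [DFA.eval_append_singleton, ← ih, D]
  have hf : A.FactorsThrough D.eval := by
    intro w w' h
    have h1 : w' ∈ (M (A w')).accepts := by rw [hM]; exact rfl
    have h2 : w ∈ (M (A w')).accepts := by
      rw [DFA.mem_accepts, ← hD, h, hD]
      exact h1
    rw [hM] at h2
    exact h2
  exact ⟨∀ o, σ o, inferInstance, D, Function.extend D.eval A (fun _ => none),
    fun w => (hf.extend_apply _ w).symm⟩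

/-- The automaton simulating derivations and emitting the observer output. -/
def rlNFA {T : Type} (G : ContextFreeGrammar T) {Sig Q : Type}
    (D : DFA (Symbol T G.NT) Q) (out : Q → Option (Option Sig)) :
    εNFA Sig (Option (Q × Option G.NT)) where
  step s l := { s' | ∃ q M, s = some (q, M) ∧
    out (D.evalFrom q (M.toList.map Symbol.nonterminal)) = l.map some ∧
    ((M = none ∧ s' = none) ∨ ∃ r ∈ G.rules, ∃ u M', M = some r.input ∧ r.output = rlForm u M' ∧
      s' = some (D.evalFrom q (u.map Symbol.terminal), M')) }
  start := {some (D.start, some G.initial)}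
  accept := {none}

lemma evalFrom_rlForm {T NT Q : Type} (D : DFA (Symbol T NT) Q) (t : List T) (M : Option NT) :
    D.evalFrom (D.eval (t.map Symbol.terminal)) (M.toList.map Symbol.nonterminal)
      = D.eval (rlForm t M) := by
  simp [DFA.eval, rlForm, DFA.evalFrom_of_append]

lemma map_some_split {Sig : Type} (o : Option (Option Sig)) (x : List Sig) (y : List (Option Sig))
    (h : x.map some = o.toList ++ y) :
    ∃ (l : Option Sig) (x' : List Sig), o = l.map some ∧ x = l.toList ++ x' ∧ x'.map some = y := by
  cases o with
  | none => exact ⟨none, x, by simp_all⟩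
  | some o =>
    cases x with
    | nil => simp at h
    | cons a x =>
      simp at h
      exact ⟨some a, x, by rw [← h.1]; rfl, by simp, h.2⟩

lemma reduceOption_cons' {Sig : Type} (l : Option Sig) (x : List (Option Sig)) :
    (l :: x).reduceOption = l.toList ++ x.reduceOption := by
  cases l <;> simp

lemma rl_path_of_chain {T : Type} {G : ContextFreeGrammar T} (hG : IsRightLinear G)
    {Sig Q : Type} (A : List (Symbol T G.NT) → Option (Option Sig))
    (D : DFA (Symbol T G.NT) Q) (out : Q → Option (Option Sig)) (hA : ∀ w, A w = out (D.eval w))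
    (ws : List (List (Symbol T G.NT))) :
    ∀ (w : List (Symbol T G.NT)) (t : List T) (M : Option G.NT) (x : List Sig), w = rlForm t M →
      List.IsChain G.Produces (w :: ws) →
      (∃ t : List T, (w :: ws).getLast? = some (t.map Symbol.terminal)) →
      x.map some = ((w :: ws).map fun w => (A w).toList).flatten →
      ∃ x', x'.reduceOption = x ∧
        (rlNFA G D out).IsPath (some (D.eval (t.map Symbol.terminal), M)) none x' := by
  induction ws with
  | nil =>
    rintro w t M x rfl - ⟨t', ht⟩ hx
    have hM : M = none := by
      cases M with
      | none => rfl
      | some N =>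
        simp only [List.getLast?_singleton, Option.some.injEq] at ht
        have : Symbol.nonterminal N ∈ rlForm t (some N) := by simp [rlForm]
        rw [ht] at this
        simp at this
    rw [List.map_cons, List.flatten_cons] at hx
    obtain ⟨l, x', h1, h2, h3⟩ := map_some_split _ _ _ hx
    have : x' = [] := by simpa using h3
    refine ⟨[l], by rw [reduceOption_cons', h2, this]; simp, ?_⟩
    rw [εNFA.isPath_singleton]
    exact ⟨_, _, rfl, by rw [evalFrom_rlForm, ← hA, h1], Or.inl ⟨hM, rfl⟩⟩
  | cons w' ws ih =>
    rintro w t M x rfl hc ht hx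
    rw [List.isChain_cons_cons] at hc
    rw [List.map_cons, List.flatten_cons] at hx
    obtain ⟨l, x', h1, h2, h3⟩ := map_some_split _ _ _ hx
    obtain ⟨r, hr, u, M', h4, h5, h6⟩ := rlForm_produces hG t M w' hc.1
    obtain ⟨y, hy, hp⟩ := ih w' (t ++ u) M' x' h6 hc.2 (by simpa using ht) h3
    refine ⟨l :: y, by rw [reduceOption_cons', h2, hy], .cons _ _ _ _ _ ?_ hp⟩
    refine ⟨_, _, rfl, by rw [evalFrom_rlForm, ← hA, h1], Or.inr ⟨r, hr, u, M', h4, h5, ?_⟩⟩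
    simp [DFA.eval, DFA.evalFrom_of_append]

lemma rl_chain_of_path {T : Type} {G : ContextFreeGrammar T}
    {Sig Q : Type} (A : List (Symbol T G.NT) → Option (Option Sig))
    (D : DFA (Symbol T G.NT) Q) (out : Q → Option (Option Sig)) (hA : ∀ w, A w = out (D.eval w))
    (x' : List (Option Sig)) :
    ∀ (t : List T) (M : Option G.NT),
      (rlNFA G D out).IsPath (some (D.eval (t.map Symbol.terminal), M)) none x' →
      ∃ ws, List.IsChain G.Produces (rlForm t M :: ws) ∧
      (∃ t' : List T, (rlForm t M :: ws).getLast? = some (t'.map Symbol.terminal)) ∧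
      x'.reduceOption.map some = ((rlForm t M :: ws).map fun w => (A w).toList).flatten := by
  induction x' with
  | nil => intro t M h; simp at h
  | cons l x' ih =>
    intro t M h
    cases h with
    | cons s _ _ _ _ hs hp =>
      obtain ⟨q, M₀, h1, h2, h3⟩ := hs
      simp only [Option.some.injEq, Prod.mk.injEq] at h1
      obtain ⟨rfl, rfl⟩ := h1
      rw [evalFrom_rlForm, ← hA] at h2
      have hl : l.toList.map some = (A (rlForm t M)).toList := by rw [h2]; cases l <;> simp
      rcases h3 with ⟨rfl, rfl⟩ | ⟨r, hr, u, M', rfl, h5, rfl⟩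
      · have : x' = [] := by
          cases hp with
          | nil => rfl
          | cons _ _ _ _ _ hs _ =>
            obtain ⟨_, _, h, _⟩ := hs
            simp at h
        subst this
        exact ⟨[], by simp, ⟨t, by simp [rlForm]⟩, by rw [reduceOption_cons']; simp [hl]⟩
      · obtain ⟨ws, hc, hlast, hx⟩ := ih (t ++ u) M' (by
          simpa [DFA.eval, DFA.evalFrom_of_append] using hp)
        refine ⟨rlForm (t ++ u) M' :: ws, ?_, by simpa using hlast, ?_⟩
        · rw [List.isChain_cons_cons]
          exact ⟨rlForm_produces_of t u M' r hr h5, hc⟩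
        · rw [reduceOption_cons', List.map_append, hx, hl]
          rw [List.map_cons (l := rlForm (t ++ u) M' :: ws), List.flatten_cons]

/-- Every regular (right-linear) grammar is nonterminal bounded: each
sentential form derivable from the start symbol contains at most one occurrence of a
nonterminal.  Consequently, for every G/O system `Ω = (G, A)` with `G` a regular grammar,
the language `L_{⊥,f}(Ω)` is regular. -/
theorem rightLinear_nonterminal_bounded_and_goLangBot_regular
    {T : Type} [Finite T] (G : ContextFreeGrammar T) [Finite G.NT]
    (hG : IsRightLinear G) :
    (∀ w : List (Symbol T G.NT),
        G.Derives [Symbol.nonterminal G.initial] w → nonterminalCount w ≤ 1) ∧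
    (∀ (Sig : Type) (_ : Finite Sig) (A : List (Symbol T G.NT) → Option (Option Sig)),
        ObserverRegular A → Language.IsRegular (goLangBot G A)) := by
  constructor
  · intro w hw
    have : ∃ t M, w = rlForm t M := by
      induction hw with
      | refl => exact ⟨[], some G.initial, rfl⟩
      | tail _ h ih =>
        obtain ⟨t, M, rfl⟩ := ih
        obtain ⟨_, _, u, M', _, _, h⟩ := rlForm_produces hG t M _ h
        exact ⟨_, _, h⟩
    obtain ⟨t, M, rfl⟩ := this
    exact rlForm_count t M
  · intro Sig _ A hA
    obtain ⟨Q, _, D, out, hD⟩ := observer_dfa A hA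
    have := Fintype.ofFinite (Set (Option (Q × Option G.NT)))
    refine ⟨_, this, (rlNFA G D out).toNFA.toDFA, ?_⟩
    rw [NFA.toDFA_correct, εNFA.toNFA_correct]
    ext x
    rw [εNFA.mem_accepts_iff_exists_path]
    constructor
    · rintro ⟨s₁, s₂, x', rfl, rfl, rfl, hp⟩
      obtain ⟨ws, h1, h2, h3⟩ := rl_chain_of_path A D out hD x' [] (some G.initial) hp
      exact ⟨_, rfl, h1, h2, h3⟩
    · rintro ⟨ws, h1, h2, h3, h4⟩
      cases ws with
      | nil => simp at h1
      | cons w ws =>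
        simp only [List.head?_cons, Option.some.injEq] at h1
        obtain ⟨x', hx, hp⟩ := rl_path_of_chain hG A D out hD ws w [] (some G.initial) x h1 h2 h3 h4
        exact ⟨_, _, x', rfl, rfl, hx, hp⟩
end
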